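/- arXiv:math/0312136 — 3 statements merged into one kernel-verified Lean document; each statement's English description precedes it below -/
import Mathlib

section
/- Let F be a cellular automaton on a closed σ-invariant set X ⊆ A^ℤ and μ a σ-ergodic and F-invariant Borel probability measure. Then h_μ(F) ≤ h_μ(σ) · (λ_μ⁺ + λ_μ⁻). -/
open MeasureTheory Filter Topology Set

noncomputable section

/-- The shift map `σ` on `ℤ → A`, defined by `(σ x) i = x (i + 1)`. -/
def shiftMap (A : Type*) : (ℤ → A) → (ℤ → A) := fun x i => x (i + 1)

/-- The iterate `σ^j` of the shift, for `j : ℤ`: `(σ^j x) i = x (i + j)`. -/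
def shiftIter {A : Type*} (j : ℤ) (x : ℤ → A) : ℤ → A := fun i => x (i + j)

/-- `F` admits a local rule of radius `r`:
`F(x)_i = f (x_{i-r}, …, x_{i+r})` for a block map `f : A^{2r+1} → A`. -/
def HasLocalRule {A : Type*} (F : (ℤ → A) → (ℤ → A)) (r : ℕ) : Prop :=
  ∃ f : (Fin (2 * r + 1) → A) → A, ∀ (x : ℤ → A) (i : ℤ),
    F x i = f fun j => x (i - (r : ℤ) + ((j : ℕ) : ℤ))

/-- `W_s⁺(x) = {y ∈ X : y_i = x_i for all i ≥ s}`. -/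
def Wplus {A : Type*} (X : Set (ℤ → A)) (s : ℤ) (x : ℤ → A) : Set (ℤ → A) :=
  {y ∈ X | ∀ i : ℤ, s ≤ i → y i = x i}

/-- `W_s⁻(x) = {y ∈ X : y_i = x_i for all i ≤ s}`. -/
def Wminus {A : Type*} (X : Set (ℤ → A)) (s : ℤ) (x : ℤ → A) : Set (ℤ → A) :=
  {y ∈ X | ∀ i : ℤ, i ≤ s → y i = x i}

/-- `Λ̃ₙ⁺(x) = min{s ≥ 0 : F^i(W₀⁺(x)) ⊆ W_s⁺(F^i(x)) for all 1 ≤ i ≤ n}`. -/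
def lamTildeP {A : Type*} (X : Set (ℤ → A)) (F : (ℤ → A) → (ℤ → A)) (n : ℕ)
    (x : ℤ → A) : ℕ :=
  sInf {s : ℕ | ∀ i : ℕ, 1 ≤ i → i ≤ n →
    F^[i] '' Wplus X 0 x ⊆ Wplus X (s : ℤ) (F^[i] x)}

/-- `Λ̃ₙ⁻(x) = min{s ≥ 0 : F^i(W₀⁻(x)) ⊆ W_{-s}⁻(F^i(x)) for all 1 ≤ i ≤ n}`. -/
def lamTildeM {A : Type*} (X : Set (ℤ → A)) (F : (ℤ → A) → (ℤ → A)) (n : ℕ)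
    (x : ℤ → A) : ℕ :=
  sInf {s : ℕ | ∀ i : ℕ, 1 ≤ i → i ≤ n →
    F^[i] '' Wminus X 0 x ⊆ Wminus X (-(s : ℤ)) (F^[i] x)}

/-- `Λₙ⁺(x) = max_{j ∈ ℤ} Λ̃ₙ⁺(σ^j x)`. -/
def lamP {A : Type*} (X : Set (ℤ → A)) (F : (ℤ → A) → (ℤ → A)) (n : ℕ)
    (x : ℤ → A) : ℕ :=
  sSup (Set.range fun j : ℤ => lamTildeP X F n (shiftIter j x))

/-- `Λₙ⁻(x) = max_{j ∈ ℤ} Λ̃ₙ⁻(σ^j x)`. -/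
def lamM {A : Type*} (X : Set (ℤ → A)) (F : (ℤ → A) → (ℤ → A)) (n : ℕ)
    (x : ℤ → A) : ℕ :=
  sSup (Set.range fun j : ℤ => lamTildeM X F n (shiftIter j x))

/-- `Iₙ⁺(x) = min{s ≥ 0 : F^i(W_{-s}⁺(x)) ⊆ W₀⁺(F^i(x)) for all 1 ≤ i ≤ n}`. -/
def Iplus {A : Type*} (X : Set (ℤ → A)) (F : (ℤ → A) → (ℤ → A)) (n : ℕ)
    (x : ℤ → A) : ℕ :=
  sInf {s : ℕ | ∀ i : ℕ, 1 ≤ i → i ≤ n →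
    F^[i] '' Wplus X (-(s : ℤ)) x ⊆ Wplus X 0 (F^[i] x)}

/-- `Iₙ⁻(x) = min{s ≥ 0 : F^i(W_s⁻(x)) ⊆ W₀⁻(F^i(x)) for all 1 ≤ i ≤ n}`. -/
def Iminus {A : Type*} (X : Set (ℤ → A)) (F : (ℤ → A) → (ℤ → A)) (n : ℕ)
    (x : ℤ → A) : ℕ :=
  sInf {s : ℕ | ∀ i : ℕ, 1 ≤ i → i ≤ n →
    F^[i] '' Wminus X (s : ℤ) x ⊆ Wminus X 0 (F^[i] x)}

/-- Average Lyapunov exponent `I_μ⁺ = liminf_n (∫ Iₙ⁺ dμ) / n`. -/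
def avgIplus {A : Type*} [MeasurableSpace A] (X : Set (ℤ → A))
    (F : (ℤ → A) → (ℤ → A)) (μ : Measure (ℤ → A)) : ℝ :=
  Filter.liminf (fun n : ℕ => (∫ x, (Iplus X F n x : ℝ) ∂μ) / n) Filter.atTop

/-- Average Lyapunov exponent `I_μ⁻ = liminf_n (∫ Iₙ⁻ dμ) / n`. -/
def avgIminus {A : Type*} [MeasurableSpace A] (X : Set (ℤ → A))
    (F : (ℤ → A) → (ℤ → A)) (μ : Measure (ℤ → A)) : ℝ :=
  Filter.liminf (fun n : ℕ => (∫ x, (Iminus X F n x : ℝ) ∂μ) / n) Filter.atTop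

/-- The topological support `S(μ)` of a measure `μ` on `ℤ → A`. -/
def msupp {A : Type*} [TopologicalSpace A] [MeasurableSpace A]
    (μ : Measure (ℤ → A)) : Set (ℤ → A) :=
  {x | ∀ U : Set (ℤ → A), IsOpen U → x ∈ U → 0 < μ U}

/-- `x` is an equicontinuous point of `F` on `X`: for every `ε = 2^{-m}` there is a
`δ = 2^{-k}` such that points of `X` agreeing with `x` on coordinates `|j| ≤ k`
have all their `F`-iterates agreeing with those of `x` on coordinates `|j| ≤ m`. -/
def IsEquicontPt {A : Type*} (X : Set (ℤ → A)) (F : (ℤ → A) → (ℤ → A))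
    (x : ℤ → A) : Prop :=
  ∀ m : ℕ, ∃ k : ℕ, ∀ y ∈ X, (∀ j : ℤ, |j| ≤ (k : ℤ) → y j = x j) →
    ∀ n : ℕ, ∀ j : ℤ, |j| ≤ (m : ℤ) → F^[n] y j = F^[n] x j

/-- Entropy `H_μ(α) = ∑ -μ(A) log μ(A)` of the finite partition given by the
fibers of `α`. -/
def partEnt {Ω : Type*} [MeasurableSpace Ω] (μ : Measure Ω) {I : Type*} [Fintype I]
    (α : Ω → I) : ℝ :=
  ∑ i : I, Real.negMulLog (μ (α ⁻¹' {i})).toReal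

/-- Metric entropy `h_μ(T, α)` of `T` relative to the finite partition `α`
(the limit of the subadditive sequence `H_μ(α ∨ T⁻¹α ∨ … ∨ T^{-n}α)/(n+1)`
equals its infimum). -/
def entropyPart {Ω : Type*} [MeasurableSpace Ω] (μ : Measure Ω) (T : Ω → Ω)
    {k : ℕ} (α : Ω → Fin k) : ℝ :=
  ⨅ n : ℕ, partEnt μ (fun x (i : Fin (n + 1)) => α (T^[(i : ℕ)] x)) / (n + 1)

/-- Kolmogorov–Sinai metric entropy `h_μ(T)`: supremum of `h_μ(T, α)` over all
finite measurable partitions `α`. -/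
def metricEntropy {Ω : Type*} [MeasurableSpace Ω] (μ : Measure Ω) (T : Ω → Ω) : ℝ :=
  ⨆ p : {q : Σ k : ℕ, Ω → Fin k // Measurable q.2}, entropyPart μ T p.1.2

/-- `B ∈ A^{2k+1}` is a blocking word for `F` (with radius `r`): there are `i` with
`2i+1 ≥ r` and words `vₙ ∈ A^{2i+1}`, independent of `x`, such that every `x ∈ X`
with `x(-k,k) = B` satisfies `F^n(x)(-i,i) = vₙ` for all `n ≥ 1`. -/
def IsBlockingWord {A : Type*} (X : Set (ℤ → A)) (F : (ℤ → A) → (ℤ → A)) (r k : ℕ)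
    (B : Fin (2 * k + 1) → A) : Prop :=
  ∃ i : ℕ, r ≤ 2 * i + 1 ∧ ∃ v : ℕ → Fin (2 * i + 1) → A,
    ∀ x ∈ X, (∀ j : Fin (2 * k + 1), x (((j : ℕ) : ℤ) - (k : ℤ)) = B j) →
      ∀ n : ℕ, 1 ≤ n → ∀ j : Fin (2 * i + 1),
        F^[n] x (((j : ℕ) : ℤ) - (i : ℤ)) = v n j

/-- `D(n, 2^{-p})`: minimal cardinality of an `(n, 2^{-p})`-covering (spanning) set
for `F`, where closeness in the Bowen metric `d_n` up to `2^{-p}` means agreement of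
all iterates `F^i`, `i ≤ n`, on the coordinates `|j| ≤ p`. -/
def coverNum {A : Type*} (F : (ℤ → A) → (ℤ → A)) (n p : ℕ) : ℕ :=
  sInf {N : ℕ | ∃ S : Finset (ℤ → A), S.card ≤ N ∧ ∀ x : ℤ → A, ∃ y ∈ S,
    ∀ i : ℕ, i ≤ n → ∀ j : ℤ, |j| ≤ (p : ℤ) → F^[i] x j = F^[i] y j}

/-- Topological entropy `h_top(F) = lim_{ε→0} lim_n (1/n) log D(n, ε)`. -/
def htop {A : Type*} (F : (ℤ → A) → (ℤ → A)) : ℝ :=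
  ⨆ p : ℕ, Filter.limsup (fun n : ℕ => Real.log (coverNum F n p) / n) Filter.atTop

end

/-! ### Shannon entropy of finite-valued maps -/

lemma sum_negMulLog_submodular {I J : Type*} [Fintype I] [Fintype J] (p : I → J → ℝ)
    (hp : ∀ i j, 0 ≤ p i j) :
    (∑ i, ∑ j, Real.negMulLog (p i j)) + Real.negMulLog (∑ i, ∑ j, p i j) ≤
      (∑ i, Real.negMulLog (∑ j, p i j)) + ∑ j, Real.negMulLog (∑ i, p i j) := by
  set a : I → ℝ := fun i => ∑ j, p i j with ha
  set b : J → ℝ := fun j => ∑ i, p i j with hb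
  set t : ℝ := ∑ i, ∑ j, p i j with ht
  have ha0 : ∀ i, 0 ≤ a i := fun i => Finset.sum_nonneg fun j _ => hp i j
  have hb0 : ∀ j, 0 ≤ b j := fun j => Finset.sum_nonneg fun i _ => hp i j
  have hta : ∑ i, a i = t := rfl
  have htb : ∑ j, b j = t := Finset.sum_comm
  have hpa : ∀ i j, p i j ≤ a i := fun i j =>
    Finset.single_le_sum (f := fun j => p i j) (fun j _ => hp i j) (Finset.mem_univ j)
  have hpb : ∀ i j, p i j ≤ b j := fun i j =>
    Finset.single_le_sum (f := fun i => p i j) (fun i _ => hp i j) (Finset.mem_univ i)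
  have hat : ∀ i, a i ≤ t := fun i =>
    Finset.single_le_sum (f := a) (fun i _ => ha0 i) (Finset.mem_univ i)
  have key : ∀ i j, Real.negMulLog (p i j) - p i j * Real.log t + p i j * Real.log (a i)
      + p i j * Real.log (b j) ≤ a i * b j / t - p i j := by
    intro i j
    rcases (hp i j).eq_or_lt with h | h
    · rw [← h]
      have : 0 ≤ a i * b j / t :=
        div_nonneg (mul_nonneg (ha0 i) (hb0 j)) ((ha0 i).trans (hat i))
      simpa using this
    · have h1 : 0 < a i := h.trans_le (hpa i j)
      have h2 : 0 < b j := h.trans_le (hpb i j)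
      have h3 : 0 < t := h1.trans_le (hat i)
      have hq : 0 < a i * b j / (p i j * t) := by positivity
      have := mul_le_mul_of_nonneg_left (Real.log_le_sub_one_of_pos hq) h.le
      rw [Real.log_div (by positivity) (by positivity), Real.log_mul h1.ne' h2.ne',
        Real.log_mul h.ne' h3.ne'] at this
      have e : p i j * (a i * b j / (p i j * t) - 1) = a i * b j / t - p i j := by
        field_simp
      rw [e] at this
      rw [Real.negMulLog]
      linarith
  have hsum := Finset.sum_le_sum fun i (_ : i ∈ Finset.univ) =>
    Finset.sum_le_sum fun j (_ : j ∈ Finset.univ) => key i j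
  have e1 : ∑ i, ∑ j, (a i * b j / t - p i j) = 0 := by
    simp only [Finset.sum_sub_distrib, ← Finset.sum_div, ← Finset.mul_sum, ← Finset.sum_mul,
      hta, htb]
    rw [← ht]
    rcases eq_or_ne t 0 with h | h
    · simp [h]
    · field_simp; simp
  have e2 : ∑ i, ∑ j, p i j * Real.log t = t * Real.log t := by
    simp only [← Finset.sum_mul]; rw [← ht]
  have e3 : ∑ i, ∑ j, p i j * Real.log (a i) = ∑ i, a i * Real.log (a i) := by
    simp only [← Finset.sum_mul]; rfl
  have e4 : ∑ i, ∑ j, p i j * Real.log (b j) = ∑ j, b j * Real.log (b j) := by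
    rw [Finset.sum_comm]; simp only [← Finset.sum_mul]; rfl
  rw [e1] at hsum
  simp only [Finset.sum_add_distrib, Finset.sum_sub_distrib, e2, e3, e4] at hsum
  simp only [Real.negMulLog, neg_mul, Finset.sum_neg_distrib] at hsum ⊢
  linarith

lemma partEnt_eq {Ω I : Type*} [MeasurableSpace Ω] [Fintype I] (μ : Measure Ω) (Y : Ω → I) :
    partEnt μ Y = ∑ i, Real.negMulLog (μ.real (Y ⁻¹' {i})) := rfl

lemma sum_measureReal_inter_preimage {Ω J : Type*} [MeasurableSpace Ω] [Fintype J]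
    [MeasurableSpace J] [MeasurableSingletonClass J] (μ : Measure Ω) [IsFiniteMeasure μ]
    {Y : Ω → J} (hY : Measurable Y) (s : Set Ω) :
    ∑ j, μ.real (s ∩ Y ⁻¹' {j}) = μ.real s := by
  have := sum_measureReal_preimage_singleton (μ := μ.restrict s) Finset.univ (f := Y)
    fun y _ => hY (measurableSet_singleton y)
  simp only [Finset.coe_univ, preimage_univ] at this
  rw [measureReal_restrict_apply_univ] at this
  rw [← this]
  refine Finset.sum_congr rfl fun j _ => ?_
  rw [measureReal_restrict_apply (hY (measurableSet_singleton j)), inter_comm]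

lemma partEnt_nonneg {Ω I : Type*} [MeasurableSpace Ω] [Fintype I] {μ : Measure Ω}
    [IsProbabilityMeasure μ] (Y : Ω → I) : 0 ≤ partEnt μ Y :=
  Finset.sum_nonneg fun _ _ => Real.negMulLog_nonneg measureReal_nonneg measureReal_le_one

/-- If `P` is a function of `Z`, then `H(P) ≤ H(Z)`. -/
lemma partEnt_le_of_factors {Ω I J : Type*} [MeasurableSpace Ω] [Fintype I] [Fintype J]
    [MeasurableSpace J] [MeasurableSingletonClass J] {μ : Measure Ω} [IsProbabilityMeasure μ]
    {P : Ω → I} {Z : Ω → J} (hZ : Measurable Z)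
    (h : ∀ x y, Z x = Z y → P x = P y) : partEnt μ P ≤ partEnt μ Z := by
  classical
  have : Nonempty Ω := μ.nonempty_of_neZero
  have : Nonempty I := this.map P
  obtain ⟨g, rfl⟩ := (Function.factorsThrough_iff P (f := Z)).1 fun x y => h x y
  rw [partEnt_eq, partEnt_eq, ← Finset.sum_fiberwise Finset.univ g]
  refine Finset.sum_le_sum fun i _ => ?_
  have e : μ.real (g ∘ Z ⁻¹' {i}) = ∑ z with g z = i, μ.real (Z ⁻¹' {z}) := by
    rw [sum_measureReal_preimage_singleton _ fun y _ => hZ (measurableSet_singleton y)]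
    congr 1
    ext x
    simp
  rw [e, Real.negMulLog, neg_mul, Finset.sum_mul, ← Finset.sum_neg_distrib]
  refine Finset.sum_le_sum fun z hz => ?_
  rw [Real.negMulLog, neg_mul, neg_le_neg_iff]
  rcases (measureReal_nonneg (μ := μ) (s := Z ⁻¹' {z})).eq_or_lt with h0 | h0
  · simp [← h0]
  · refine mul_le_mul_of_nonneg_left (Real.log_le_log h0 ?_) h0.le
    exact Finset.single_le_sum (f := fun z => μ.real (Z ⁻¹' {z}))
      (fun _ _ => measureReal_nonneg) hz

lemma partEnt_comp {Ω I : Type*} [MeasurableSpace Ω] [Fintype I] [MeasurableSpace I]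
    [MeasurableSingletonClass I] {μ : Measure Ω} {T : Ω → Ω} (hT : MeasurePreserving T μ μ) {Y : Ω → I} (hY : Measurable Y) :
    partEnt μ (fun x => Y (T x)) = partEnt μ Y := by
  refine Finset.sum_congr rfl fun i _ => ?_
  rw [← hT.measure_preimage (hY (measurableSet_singleton i)).nullMeasurableSet]
  rfl

section Entropy

variable {Ω : Type*} [MeasurableSpace Ω] {μ : Measure Ω} [IsProbabilityMeasure μ]

/-- Strong subadditivity of entropy. -/
lemma partEnt_triple_add_le {I J K : Type*} [Fintype K]
    [Fintype I] [MeasurableSpace I] [MeasurableSingletonClass I]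
    [Fintype J] [MeasurableSpace J] [MeasurableSingletonClass J]
    {U : Ω → I} {V : Ω → J} {W : Ω → K} (hU : Measurable U)
    (hV : Measurable V) :
    partEnt μ (fun x => ((U x, V x), W x)) + partEnt μ W ≤
      partEnt μ (fun x => (U x, W x)) + partEnt μ (fun x => (V x, W x)) := by
  set p : K → I → J → ℝ := fun k i j => μ.real ((W ⁻¹' {k} ∩ U ⁻¹' {i}) ∩ V ⁻¹' {j}) with hp
  have h1 : ∀ k i, ∑ j, p k i j = μ.real (W ⁻¹' {k} ∩ U ⁻¹' {i}) := fun k i =>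
    sum_measureReal_inter_preimage μ hV _
  have h2 : ∀ k j, ∑ i, p k i j = μ.real (W ⁻¹' {k} ∩ V ⁻¹' {j}) := fun k j => by
    rw [← sum_measureReal_inter_preimage μ hU (W ⁻¹' {k} ∩ V ⁻¹' {j})]
    simp only [hp, inter_right_comm]
  have key := Finset.sum_le_sum fun k (_ : k ∈ Finset.univ) =>
    sum_negMulLog_submodular (p k) fun i j => measureReal_nonneg
  simp only [Finset.sum_add_distrib, h1, h2,
    sum_measureReal_inter_preimage μ hU] at key
  simp only [partEnt_eq, Fintype.sum_prod_type_right]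
  have r1 : ∀ i j k, (fun x => ((U x, V x), W x)) ⁻¹' {((i, j), k)} =
      (W ⁻¹' {k} ∩ U ⁻¹' {i}) ∩ V ⁻¹' {j} := fun i j k => by
    ext x; simp; tauto
  have r2 : ∀ i k, (fun x => (U x, W x)) ⁻¹' {(i, k)} = W ⁻¹' {k} ∩ U ⁻¹' {i} := fun i k => by
    ext x; simp; tauto
  have r3 : ∀ i k, (fun x => (V x, W x)) ⁻¹' {(i, k)} = W ⁻¹' {k} ∩ V ⁻¹' {i} := fun i k => by
    ext x; simp; tauto
  simp only [r1, r2, r3]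
  refine le_of_eq_of_le ?_ key
  congr 1
  refine Finset.sum_congr rfl fun k _ => ?_
  rw [Finset.sum_comm]

/-- Submodularity of entropy: `P` is a function of `(Y, Z)`, and `Q` is a function of each of
`Y` and `Z`. -/
lemma partEnt_submodular {I J K L : Type*} [Fintype I]
    [Fintype J] [MeasurableSpace J] [MeasurableSingletonClass J]
    [Fintype K] [MeasurableSpace K] [MeasurableSingletonClass K]
    [Fintype L] [MeasurableSpace L] [MeasurableSingletonClass L]
    {P : Ω → I} {Q : Ω → J} {Y : Ω → K} {Z : Ω → L}
    (hQ : Measurable Q) (hY : Measurable Y) (hZ : Measurable Z)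
    (hP : ∀ x y, Y x = Y y → Z x = Z y → P x = P y)
    (hQY : ∀ x y, Y x = Y y → Q x = Q y) (hQZ : ∀ x y, Z x = Z y → Q x = Q y) :
    partEnt μ P + partEnt μ Q ≤ partEnt μ Y + partEnt μ Z := by
  have h := partEnt_triple_add_le (μ := μ) (W := Q) hY hZ
  have h1 : partEnt μ P ≤ partEnt μ (fun x => ((Y x, Z x), Q x)) :=
    partEnt_le_of_factors ((hY.prodMk hZ).prodMk hQ) fun x y h => by
      simp only [Prod.mk.injEq] at h
      exact hP x y h.1.1 h.1.2
  have h2 : partEnt μ (fun x => (Y x, Q x)) ≤ partEnt μ Y :=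
    partEnt_le_of_factors hY fun x y h => Prod.ext h (hQY x y h)
  have h3 : partEnt μ (fun x => (Z x, Q x)) ≤ partEnt μ Z :=
    partEnt_le_of_factors hZ fun x y h => Prod.ext h (hQZ x y h)
  linarith

lemma partEnt_prod_le {I J : Type*}
    [Fintype I] [MeasurableSpace I] [MeasurableSingletonClass I]
    [Fintype J] [MeasurableSpace J] [MeasurableSingletonClass J]
    {Y : Ω → I} {Z : Ω → J} (hY : Measurable Y) (hZ : Measurable Z) :
    partEnt μ (fun x => (Y x, Z x)) ≤ partEnt μ Y + partEnt μ Z := by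
  have h := partEnt_submodular (μ := μ) (P := fun x => (Y x, Z x)) (Q := fun _ => ())
    measurable_const hY hZ (fun x y h1 h2 => Prod.ext h1 h2) (fun _ _ _ => rfl) fun _ _ _ => rfl
  have := partEnt_nonneg (μ := μ) (fun _ => ())
  linarith

/-- A variable that is almost constant has small entropy. -/
lemma exists_partEnt_le_of_measure_ne_none_lt (μ : Measure Ω) [IsProbabilityMeasure μ]
    (I : Type*) [Fintype I] {ε : ℝ} (hε : 0 < ε) :
    ∃ δ : ℝ, 0 < δ ∧ ∀ W : Ω → Option I, MeasurableSet {x | W x ≠ none} →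
      μ.real {x | W x ≠ none} < δ → partEnt μ W ≤ ε := by
  have hc : 0 < ε / (Fintype.card I + 1) := by positivity
  have c0 := Metric.continuousAt_iff.1 (Real.continuous_negMulLog.continuousAt (x := 0)) _ hc
  have c1 := Metric.continuousAt_iff.1 (Real.continuous_negMulLog.continuousAt (x := 1)) _ hc
  obtain ⟨d0, hd0, h0⟩ := c0
  obtain ⟨d1, hd1, h1⟩ := c1
  refine ⟨min d0 d1, lt_min hd0 hd1, fun W hm hW => ?_⟩
  rw [partEnt_eq, Fintype.sum_option]
  have e : μ.real (W ⁻¹' {none}) = 1 - μ.real {x | W x ≠ none} := by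
    rw [← probReal_compl_eq_one_sub hm]
    congr 1
    ext x; simp
  have a1 : Real.negMulLog (μ.real (W ⁻¹' {none})) ≤ ε / (Fintype.card I + 1) := by
    have := @h1 (μ.real (W ⁻¹' {none})) (by
      rw [e, Real.dist_eq, sub_sub_cancel_left, abs_neg, abs_of_nonneg measureReal_nonneg]
      exact hW.trans_le (min_le_right _ _))
    rw [Real.dist_eq, Real.negMulLog_one, sub_zero] at this
    exact (le_abs_self _).trans this.le
  have a0 : ∀ i, Real.negMulLog (μ.real (W ⁻¹' {some i})) ≤ ε / (Fintype.card I + 1) := by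
    intro i
    have hle : μ.real (W ⁻¹' {some i}) ≤ μ.real {x | W x ≠ none} :=
      measureReal_mono fun x hx => by
        simp only [mem_preimage, mem_singleton_iff] at hx
        simp [hx]
    have := @h0 (μ.real (W ⁻¹' {some i})) (by
      rw [Real.dist_eq, sub_zero, abs_of_nonneg measureReal_nonneg]
      exact (hle.trans_lt hW).trans_le (min_le_left _ _))
    rw [Real.dist_eq, Real.negMulLog_zero, sub_zero] at this
    exact (le_abs_self _).trans this.le
  calc _ ≤ ε / (Fintype.card I + 1) + ∑ _i : I, ε / (Fintype.card I + 1) :=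
        add_le_add a1 (Finset.sum_le_sum fun i _ => a0 i)
    _ = ε := by
        rw [Finset.sum_const, Finset.card_univ, nsmul_eq_mul]
        field_simp
        ring

/-- If `H(α | β) ≤ c`, then `H(α ∨ … ∨ T⁻⁽ᵐ⁻¹⁾α) ≤ H(β ∨ … ∨ T⁻⁽ᵐ⁻¹⁾β) + m c`. -/
lemma partEnt_orbit_le {I J : Type*}
    [Fintype I] [MeasurableSpace I] [MeasurableSingletonClass I]
    [Fintype J] [MeasurableSpace J] [MeasurableSingletonClass J]
    {T : Ω → Ω} (hT : MeasurePreserving T μ μ) {α : Ω → I} {β : Ω → J}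
    (hα : Measurable α) (hβ : Measurable β) {c : ℝ}
    (hc : partEnt μ (fun x => (α x, β x)) ≤ partEnt μ β + c) (m : ℕ) :
    partEnt μ (fun x (i : Fin m) => α (T^[(i : ℕ)] x)) ≤
      partEnt μ (fun x (i : Fin m) => β (T^[(i : ℕ)] x)) + m * c := by
  have hTi : ∀ i : ℕ, Measurable (T^[i]) := fun i => hT.measurable.iterate i
  have hB : Measurable fun x (i : Fin m) => β (T^[(i : ℕ)] x) :=
    measurable_pi_lambda _ fun i => hβ.comp (hTi i)
  have hA : ∀ k, Measurable fun x (i : Fin k) => α (T^[(i : ℕ)] x) := fun k =>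
    measurable_pi_lambda _ fun i => hα.comp (hTi i)
  have key : ∀ k ≤ m, partEnt μ (fun x => ((fun i : Fin k => α (T^[(i : ℕ)] x)),
      fun i : Fin m => β (T^[(i : ℕ)] x))) ≤
      partEnt μ (fun x (i : Fin m) => β (T^[(i : ℕ)] x)) + k * c := by
    intro k
    induction k with
    | zero =>
      intro _
      have := partEnt_le_of_factors (μ := μ) (P := fun x => ((fun i : Fin 0 => α (T^[(i : ℕ)] x)),
        fun i : Fin m => β (T^[(i : ℕ)] x))) hB fun x y h => Prod.ext (Subsingleton.elim _ _) h
      simpa using this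
    | succ k ih =>
      intro hk
      have h := partEnt_submodular (μ := μ)
        (P := fun x => ((fun i : Fin (k + 1) => α (T^[(i : ℕ)] x)),
          fun i : Fin m => β (T^[(i : ℕ)] x)))
        (Q := fun x => β (T^[k] x))
        (Y := fun x => ((fun i : Fin k => α (T^[(i : ℕ)] x)),
          fun i : Fin m => β (T^[(i : ℕ)] x)))
        (Z := fun x => (α (T^[k] x), β (T^[k] x)))
        (hβ.comp (hTi k)) ((hA k).prodMk hB)
        ((hα.comp (hTi k)).prodMk (hβ.comp (hTi k)))
        (fun x y h1 h2 => by
          simp only [Prod.mk.injEq] at h1 h2 ⊢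
          refine ⟨funext fun i => ?_, h1.2⟩
          induction i using Fin.lastCases with
          | last => simpa using h2.1
          | cast i => exact congrFun h1.1 i)
        (fun x y h1 => by
          simp only [Prod.mk.injEq] at h1
          exact congrFun h1.2 ⟨k, hk⟩)
        (fun x y h1 => by
          simp only [Prod.mk.injEq] at h1
          exact h1.2)
      have e1 := partEnt_comp (hT.iterate k) hβ
      have e2 := partEnt_comp (hT.iterate k) (hα.prodMk hβ)
      rw [e1, e2] at h
      have := ih (by omega)
      push_cast
      linarith
  refine le_trans (partEnt_le_of_factors ((hA m).prodMk hB) fun x y h => ?_) (key m le_rfl)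
  simp only [Prod.mk.injEq] at h
  exact h.1

end Entropy

/-! ### Approximation by finitely many coordinates -/

section Approximation

variable {A : Type*} [Fintype A] [TopologicalSpace A] [DiscreteTopology A]
  [MeasurableSpace A] [BorelSpace A] {μ : Measure (ℤ → A)} [IsProbabilityMeasure μ]
  {I : Type*} [Fintype I] [MeasurableSpace I] [MeasurableSingletonClass I]

/-- A compact set of pairs of distinguishable points is distinguished by finitely many
coordinates. -/
lemma exists_coordinate_bound {A : Type*} [TopologicalSpace A] [DiscreteTopology A]
    {S : Set ℤ} {D : Set ((ℤ → A) × (ℤ → A))} (hD : IsCompact D)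
    (h : ∀ q ∈ D, ∃ s ∈ S, q.1 s ≠ q.2 s) :
    ∃ M : ℕ, ∀ q ∈ D, ∃ s ∈ S, |s| ≤ (M : ℤ) ∧ q.1 s ≠ q.2 s := by
  obtain ⟨M, hM⟩ := hD.elim_directed_cover
    (fun M : ℕ => {q : (ℤ → A) × (ℤ → A) | ∃ s ∈ S, |s| ≤ (M : ℤ) ∧ q.1 s ≠ q.2 s})
    (fun M => by
      have e : {q : (ℤ → A) × (ℤ → A) | ∃ s ∈ S, |s| ≤ (M : ℤ) ∧ q.1 s ≠ q.2 s} =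
          ⋃ s : {s : ℤ // s ∈ S ∧ |s| ≤ (M : ℤ)},
            {q : (ℤ → A) × (ℤ → A) | q.1 s ≠ q.2 s} := by
        ext q; simp [and_assoc]
      rw [e]
      refine isOpen_iUnion fun s => ?_
      exact isOpen_ne_fun ((continuous_apply _).comp continuous_fst)
        ((continuous_apply _).comp continuous_snd))
    (fun q hq => by
      obtain ⟨s, hs, hne⟩ := h q hq
      exact mem_iUnion.2 ⟨s.natAbs, s, hs, by simp, hne⟩)
    (directed_of_isDirected_le fun a b hab q hq => by
      obtain ⟨s, hs, hle, hne⟩ := hq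
      exact ⟨s, hs, hle.trans (by exact_mod_cast hab), hne⟩)
  exact ⟨M, hM⟩

/-- If `Y` is almost surely a function of the coordinates in `S`, then `H(Y | Z)` is small as
soon as `Z` determines sufficiently many of these coordinates. -/
lemma exists_partEnt_prod_le_add {Y : (ℤ → A) → I} (hY : Measurable Y) {G : Set (ℤ → A)}
    (hG : MeasurableSet G) (hG1 : ∀ᵐ x ∂μ, x ∈ G) {S : Set ℤ}
    (hS : ∀ x ∈ G, ∀ y ∈ G, (∀ s ∈ S, x s = y s) → Y x = Y y) {ε : ℝ} (hε : 0 < ε) :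
    ∃ M : ℕ, ∀ {n : ℕ} (Z : (ℤ → A) → Fin n → A), Measurable Z →
      (∀ x y, Z x = Z y → ∀ s ∈ S, |s| ≤ (M : ℤ) → x s = y s) →
      partEnt μ (fun x => (Y x, Z x)) ≤ partEnt μ Z + ε := by
  classical
  obtain ⟨δ, hδ, hsmall⟩ := exists_partEnt_le_of_measure_ne_none_lt μ I hε
  have hδ' : 0 < δ / (Fintype.card I + 1) := by positivity
  have hK : ∀ i, ∃ K ⊆ G ∩ Y ⁻¹' {i}, IsCompact K ∧
      μ ((G ∩ Y ⁻¹' {i}) \ K) < ENNReal.ofReal (δ / (Fintype.card I + 1)) := fun i =>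
    (hG.inter (hY (measurableSet_singleton i))).exists_isCompact_sdiff_lt (measure_ne_top _ _)
      (by simpa using hδ')
  choose K hKs hKc hKμ using hK
  set D : Set ((ℤ → A) × (ℤ → A)) := ⋃ q : {q : I × I // q.1 ≠ q.2}, K q.1.1 ×ˢ K q.1.2 with hDdef
  have hDc : IsCompact D := isCompact_iUnion fun q => (hKc _).prod (hKc _)
  obtain ⟨M, hM⟩ := exists_coordinate_bound (S := S) hDc (by
    rintro ⟨x, y⟩ hq
    obtain ⟨⟨⟨i, j⟩, hij⟩, hx, hy⟩ := mem_iUnion.1 hq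
    by_contra! hcon
    have := hS x (hKs _ hx).1 y (hKs _ hy).1 hcon
    have h1 : Y x = i := (hKs _ hx).2
    have h2 : Y y = j := (hKs _ hy).2
    exact hij (by rw [← h1, ← h2, this]))
  refine ⟨M, fun {n} Z hZ hZM => ?_⟩
  set U : Set (ℤ → A) := ⋃ i, K i with hU
  have hUm : MeasurableSet U := MeasurableSet.iUnion fun i => (hKc i).isClosed.measurableSet
  set W : (ℤ → A) → Option I := fun x => if x ∈ U then none else some (Y x) with hW
  let _ : MeasurableSpace (Option I) := ⊤
  have hWm : Measurable W := Measurable.ite hUm measurable_const 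
    ((measurable_of_countable (some : I → Option I)).comp hY)
  have hne : {x | W x ≠ none} = Uᶜ := by
    ext x
    by_cases hx : x ∈ U <;> simp [hW, hx]
  have hμ : μ.real Uᶜ < δ := by
    have hsub : Uᶜ ⊆ Gᶜ ∪ ⋃ i, ((G ∩ Y ⁻¹' {i}) \ K i) := by
      intro x hx
      by_cases hxG : x ∈ G
      · refine Or.inr (mem_iUnion.2 ⟨Y x, ⟨hxG, rfl⟩, fun hxK => hx (mem_iUnion.2 ⟨_, hxK⟩)⟩)
      · exact Or.inl hxG
    have h0 : μ.real Gᶜ = 0 := by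
      rw [measureReal_def, (mem_ae_iff.1 hG1 : μ Gᶜ = 0), ENNReal.toReal_zero]
    calc μ.real Uᶜ ≤ μ.real (Gᶜ ∪ ⋃ i, ((G ∩ Y ⁻¹' {i}) \ K i)) := measureReal_mono hsub
      _ ≤ μ.real Gᶜ + ∑ i, μ.real ((G ∩ Y ⁻¹' {i}) \ K i) :=
        (measureReal_union_le _ _).trans (add_le_add le_rfl (measureReal_iUnion_fintype_le _))
      _ ≤ 0 + ∑ _i : I, δ / (Fintype.card I + 1) := by
        rw [h0]
        refine add_le_add le_rfl (Finset.sum_le_sum fun i _ => ?_)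
        exact ENNReal.toReal_le_of_le_ofReal hδ'.le (hKμ i).le
      _ < δ := by
        rw [Finset.sum_const, Finset.card_univ, nsmul_eq_mul, zero_add, ← mul_div_assoc,
          div_lt_iff₀ (by positivity)]
        linarith
  have hWε : partEnt μ W ≤ ε := hsmall W (hne ▸ hUm.compl) (by rwa [hne])
  refine (partEnt_le_of_factors (hZ.prodMk hWm) fun x y h => ?_).trans
    ((partEnt_prod_le hZ hWm).trans (add_le_add le_rfl hWε))
  simp only [Prod.mk.injEq] at h ⊢
  have hZxy := h.1
  refine ⟨?_, hZxy⟩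
  by_cases hx : x ∈ U <;> by_cases hy : y ∈ U <;> simp [hW, hx, hy] at h
  · obtain ⟨i, hi⟩ := mem_iUnion.1 hx
    obtain ⟨j, hj⟩ := mem_iUnion.1 hy
    have h1 : Y x = i := (hKs _ hi).2
    have h2 : Y y = j := (hKs _ hj).2
    by_contra hne
    obtain ⟨s, hs, hsM, hxy⟩ := hM (x, y) (mem_iUnion.2 ⟨⟨(i, j), by rwa [← h1, ← h2]⟩, hi, hj⟩)
    exact hxy (hZM x y hZxy s hs hsM)
  · exact h.2

end Approximation

/-! ### Entropy of words -/

/-- The word of length `n` of `x` starting at coordinate `a`. -/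
def word {A : Type*} (a : ℤ) (n : ℕ) (x : ℤ → A) : Fin n → A := fun i => x (a + ((i : ℕ) : ℤ))

lemma word_eq_iff {A : Type*} {a : ℤ} {n : ℕ} {x y : ℤ → A} :
    word a n x = word a n y ↔ ∀ k, a ≤ k → k < a + n → x k = y k := by
  refine ⟨fun h k hk hk' => ?_, fun h => funext fun i => h _ (by omega) (by omega)⟩
  have := congrFun h ⟨(k - a).toNat, by omega⟩
  simp only [word] at this
  rwa [show a + (((k - a).toNat : ℕ) : ℤ) = k by omega] at this

lemma measurable_word {A : Type*} [MeasurableSpace A] (a : ℤ) (n : ℕ) :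
    Measurable (word (A := A) a n) :=
  measurable_pi_lambda _ fun _ => measurable_pi_apply _

/-- Entropy of the words of length `n` starting at the origin. -/
noncomputable def wordEnt {A : Type*} [Fintype A] [MeasurableSpace A] (μ : Measure (ℤ → A)) (n : ℕ) : ℝ :=
  partEnt μ (word (A := A) 0 n)

section WordEntropy

variable {A : Type*} [Fintype A] [MeasurableSpace A] [MeasurableSingletonClass A]
  {μ : Measure (ℤ → A)}

lemma partEnt_word (hσ : MeasurePreserving (shiftMap A) μ μ) (a : ℤ) (n : ℕ) :
    partEnt μ (word (A := A) a n) = wordEnt μ n := by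
  have step : ∀ a : ℤ, partEnt μ (word (A := A) (a + 1) n) = partEnt μ (word (A := A) a n) := by
    intro a
    rw [← partEnt_comp hσ (measurable_word a n)]
    congr 1
    funext x i
    simp only [word, shiftMap]
    congr 1
    ring
  induction a using Int.induction_on with
  | zero => rfl
  | succ i ih => rw [step, ih]
  | pred i ih => rw [← ih, ← step (-(i : ℤ) - 1), sub_add_cancel]

variable [IsProbabilityMeasure μ]

lemma wordEnt_le_succ (n : ℕ) : wordEnt μ n ≤ wordEnt μ (n + 1) :=
  partEnt_le_of_factors (measurable_word _ _) fun x y h =>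
    word_eq_iff.2 fun k h1 h2 => word_eq_iff.1 h k h1 (by push_cast; omega)

lemma wordEnt_add_two_add_le (hσ : MeasurePreserving (shiftMap A) μ μ) (n : ℕ) :
    wordEnt μ (n + 2) + wordEnt μ n ≤ wordEnt μ (n + 1) + wordEnt μ (n + 1) := by
  rw [← partEnt_word hσ 1 n, ← partEnt_word hσ 0 (n + 2)]
  nth_rewrite 2 [← partEnt_word hσ 1 (n + 1)]
  refine partEnt_submodular (measurable_word _ _) (measurable_word _ _) (measurable_word _ _)
    (fun x y h1 h2 => ?_) (fun x y h => ?_) (fun x y h => ?_)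
  · rw [word_eq_iff] at *
    intro k hk hk'
    by_cases hk0 : k < n + 1
    · exact h1 k hk (by push_cast; omega)
    · exact h2 k (by omega) (by push_cast at hk' ⊢; omega)
  · rw [word_eq_iff] at *
    exact fun k hk hk' => h k (by omega) (by push_cast; omega)
  · rw [word_eq_iff] at *
    exact fun k hk hk' => h k (by omega) (by push_cast; omega)

/-- The conditional entropy of a letter given the `n` preceding ones. -/
noncomputable def letterEnt (μ : Measure (ℤ → A)) (n : ℕ) : ℝ := wordEnt μ (n + 1) - wordEnt μ n

lemma letterEnt_nonneg (n : ℕ) : 0 ≤ letterEnt μ n :=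
  sub_nonneg.2 (wordEnt_le_succ n)

lemma bddBelow_letterEnt : BddBelow (range (letterEnt μ)) :=
  ⟨0, by rintro _ ⟨n, rfl⟩; exact letterEnt_nonneg n⟩

lemma antitone_letterEnt (hσ : MeasurePreserving (shiftMap A) μ μ) : Antitone (letterEnt μ) :=
  antitone_nat_of_succ_le fun n => by
    have := wordEnt_add_two_add_le hσ n
    simp only [letterEnt]
    linarith

lemma wordEnt_add_le (hσ : MeasurePreserving (shiftMap A) μ μ) (a k : ℕ) :
    wordEnt μ (a + k) ≤ wordEnt μ a + k * letterEnt μ a := by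
  induction k with
  | zero => simp
  | succ k ih =>
    have h := antitone_letterEnt hσ (Nat.le_add_right a k)
    simp only [letterEnt] at h ih ⊢
    push_cast
    rw [← add_assoc]
    linarith

lemma le_wordEnt_add (a k : ℕ) :
    wordEnt μ a + k * (⨅ n, letterEnt μ n) ≤ wordEnt μ (a + k) := by
  induction k with
  | zero => simp
  | succ k ih =>
    have h := ciInf_le (bddBelow_letterEnt (μ := μ)) (a + k)
    rw [show letterEnt μ (a + k) = wordEnt μ (a + (k + 1)) - wordEnt μ (a + k) from rfl] at h
    push_cast
    linarith

lemma wordEnt_le_mul (hσ : MeasurePreserving (shiftMap A) μ μ) (n : ℕ) :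
    wordEnt μ n ≤ (n + 1) * wordEnt μ 1 := by
  have h := wordEnt_add_le hσ 0 n
  have h1 := wordEnt_le_succ (μ := μ) 0
  simp only [letterEnt, zero_add] at h h1
  have h0 : 0 ≤ wordEnt μ 0 := partEnt_nonneg _
  nlinarith [mul_nonneg (Nat.cast_nonneg (α := ℝ) n) h0]

end WordEntropy

/-- If `Y` is almost surely a function of the coordinates `≥ a`, almost surely a function of the
coordinates `< a + N`, and a function of the coordinates in `[a - q, a + N + q)`, then its entropy
exceeds the entropy of words of length `N` by at most `2 q (h(N) - h)`, where `h(N)` is the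
conditional entropy of a letter given the `N` preceding ones and `h` is the limit of `h(N)`. -/
lemma partEnt_le_of_two_sided {A I : Type*} [Fintype A] [TopologicalSpace A] [DiscreteTopology A]
    [MeasurableSpace A] [BorelSpace A] [Fintype I] [MeasurableSpace I] [MeasurableSingletonClass I]
    {μ : Measure (ℤ → A)} [IsProbabilityMeasure μ] (hσ : MeasurePreserving (shiftMap A) μ μ)
    {Y : (ℤ → A) → I} (hY : Measurable Y) {G : Set (ℤ → A)} (hG : MeasurableSet G)
    (hG1 : ∀ᵐ x ∂μ, x ∈ G) (a : ℤ) (N q : ℕ)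
    (hR : ∀ x ∈ G, ∀ y ∈ G, (∀ k, a ≤ k → x k = y k) → Y x = Y y)
    (hL : ∀ x ∈ G, ∀ y ∈ G, (∀ k, k < a + N → x k = y k) → Y x = Y y)
    (hloc : ∀ x y, (∀ k, a - q ≤ k → k < a + N + q → x k = y k) → Y x = Y y)
    {ε : ℝ} (hε : 0 < ε) :
    partEnt μ Y ≤
      wordEnt μ N + 2 * q * (letterEnt μ N - ⨅ n, letterEnt μ n) + 2 * ε := by
  obtain ⟨M₁, hM₁⟩ := exists_partEnt_prod_le_add hY hG hG1 (S := {k | a ≤ k}) hR hε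
  obtain ⟨M₂, hM₂⟩ := exists_partEnt_prod_le_add hY hG hG1 (S := {k | k < a + N}) hL hε
  set M : ℕ := M₁ + M₂ + a.natAbs + q + 1 with hM
  have hR' := hM₁ (word a (N + M)) (measurable_word _ _) fun x y h s hs hsM =>
    word_eq_iff.1 h s hs (by have := le_abs_self s; push_cast; omega)
  have hL' := hM₂ (word (a - M) (N + M)) (measurable_word _ _) fun x y h s hs hsM =>
    word_eq_iff.1 h s (by have := neg_abs_le s; omega)
      (by simp only [mem_ofPred_eq] at hs; push_cast; omega)
  have s1 := partEnt_submodular (μ := μ) (P := word (a - q) (N + M + q))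
    (Q := fun x => (Y x, word a (N + q) x)) (Y := fun x => (Y x, word a (N + M) x))
    (Z := word (a - q) (N + q + q)) (hY.prodMk (measurable_word _ _))
    (hY.prodMk (measurable_word _ _)) (measurable_word _ _)
    (fun x y h1 h2 => by
      simp only [Prod.mk.injEq, word_eq_iff] at *
      intro k hk hk'
      by_cases h : k < a
      · exact h2 k hk (by push_cast; omega)
      · exact h1.2 k (by omega) (by push_cast at *; omega))
    (fun x y h => by
      simp only [Prod.mk.injEq, word_eq_iff] at *
      exact ⟨h.1, fun k hk hk' => h.2 k hk (by push_cast at *; omega)⟩)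
    (fun x y h => by
      simp only [Prod.mk.injEq, word_eq_iff] at *
      exact ⟨hloc x y fun k hk hk' => h k hk (by push_cast at *; omega),
        fun k hk hk' => h k (by omega) (by push_cast at *; omega)⟩)
  have s2 := partEnt_submodular (μ := μ) (P := word (a - M) (N + M + q))
    (Q := fun x => (Y x, word a N x)) (Y := fun x => (Y x, word a (N + q) x))
    (Z := fun x => (Y x, word (a - M) (N + M) x)) (hY.prodMk (measurable_word _ _))
    (hY.prodMk (measurable_word _ _)) (hY.prodMk (measurable_word _ _))
    (fun x y h1 h2 => by
      simp only [Prod.mk.injEq, word_eq_iff] at *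
      intro k hk hk'
      by_cases h : k < a
      · exact h2.2 k hk (by push_cast; omega)
      · exact h1.2 k (by omega) (by push_cast at *; omega))
    (fun x y h => by
      simp only [Prod.mk.injEq, word_eq_iff] at *
      exact ⟨h.1, fun k hk hk' => h.2 k hk (by push_cast at *; omega)⟩)
    (fun x y h => by
      simp only [Prod.mk.injEq, word_eq_iff] at *
      exact ⟨h.1, fun k hk hk' => h.2 k (by omega) (by push_cast at *; omega)⟩)
  have s3 : partEnt μ Y ≤ partEnt μ (fun x => (Y x, word a N x)) :=
    partEnt_le_of_factors (hY.prodMk (measurable_word _ _)) fun x y h => (Prod.mk.inj h).1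
  simp only [partEnt_word hσ] at s1 s2 hR' hL'
  have e1 := le_wordEnt_add (μ := μ) (N + M) q
  have e2 := wordEnt_add_le hσ (N + q) q
  have e3 := wordEnt_add_le hσ N q
  have e4 := mul_le_mul_of_nonneg_left (antitone_letterEnt hσ (Nat.le_add_right N q))
    (Nat.cast_nonneg (α := ℝ) q)
  linarith

/-! ### Kolmogorov–Sinai entropy of the shift -/

lemma bddBelow_entropyPart {Ω I : Type*} [MeasurableSpace Ω] [Fintype I] (μ : Measure Ω)
    [IsProbabilityMeasure μ] (T : Ω → Ω) (α : Ω → I) :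
    BddBelow (range fun n : ℕ =>
      partEnt μ (fun x (i : Fin (n + 1)) => α (T^[(i : ℕ)] x)) / ((n : ℝ) + 1)) :=
  ⟨0, by rintro _ ⟨n, rfl⟩; exact div_nonneg (partEnt_nonneg _) (by positivity)⟩

lemma entropyPart_mul_le {Ω : Type*} [MeasurableSpace Ω] (μ : Measure Ω)
    [IsProbabilityMeasure μ] (T : Ω → Ω) {k : ℕ} (α : Ω → Fin k) (n : ℕ) :
    entropyPart μ T α * (n + 1) ≤
      partEnt μ (fun x (i : Fin (n + 1)) => α (T^[(i : ℕ)] x)) :=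
  (le_div_iff₀ (by positivity)).1 (ciInf_le (bddBelow_entropyPart μ T α) n)

lemma shiftMap_iterate_apply {A : Type*} (n : ℕ) (x : ℤ → A) (k : ℤ) :
    (shiftMap A)^[n] x k = x (k + n) := by
  induction n generalizing x with
  | zero => simp
  | succ n ih =>
    rw [Function.iterate_succ_apply, ih, shiftMap]
    congr 1
    push_cast
    ring

section Shift

variable {A : Type*} [Fintype A] [TopologicalSpace A] [DiscreteTopology A]
  [MeasurableSpace A] [BorelSpace A] {μ : Measure (ℤ → A)} [IsProbabilityMeasure μ]

/-- Large central words almost determine any finite partition. -/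
lemma exists_partEnt_word_le_add {I : Type*} [Fintype I] [MeasurableSpace I]
    [MeasurableSingletonClass I] {α : (ℤ → A) → I} (hα : Measurable α) {ε : ℝ} (hε : 0 < ε) :
    ∃ M : ℕ, ∀ p ≥ M, partEnt μ (fun x => (α x, word (-(p : ℤ)) (2 * p + 1) x)) ≤
      partEnt μ (word (A := A) (-(p : ℤ)) (2 * p + 1)) + ε := by
  obtain ⟨M, hM⟩ := exists_partEnt_prod_le_add (μ := μ) hα MeasurableSet.univ
    (Eventually.of_forall fun x => mem_univ x) (S := univ)
    (fun x _ y _ h => congrArg α (funext fun s => h s (mem_univ s))) hε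
  refine ⟨M, fun p hp => hM _ (measurable_word _ _) fun x y h s _ hs => ?_⟩
  have := abs_le.1 hs
  exact word_eq_iff.1 h s (by omega) (by push_cast; omega)

lemma bddAbove_entropyPart_shiftMap (hσ : MeasurePreserving (shiftMap A) μ μ) :
    BddAbove (range fun p : {q : Σ k : ℕ, (ℤ → A) → Fin k // Measurable q.2} =>
      entropyPart μ (shiftMap A) p.1.2) := by
  refine ⟨2 * wordEnt μ 1 + 1, ?_⟩
  rintro _ ⟨⟨⟨k, α⟩, hα⟩, rfl⟩
  obtain ⟨M, hM⟩ := exists_partEnt_word_le_add (μ := μ) hα one_pos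
  have h1 := partEnt_orbit_le hσ hα (measurable_word _ _) (hM M le_rfl) (2 * M + 1 + 1)
  have h2 : partEnt μ (fun x (i : Fin (2 * M + 1 + 1)) =>
      word (-(M : ℤ)) (2 * M + 1) ((shiftMap A)^[(i : ℕ)] x)) ≤
      partEnt μ (word (A := A) (-(M : ℤ)) (2 * M + 1 + (2 * M + 1))) := by
    refine partEnt_le_of_factors (measurable_word _ _) fun x y h => funext fun i => ?_
    rw [word_eq_iff] at h ⊢
    intro k hk hk'
    rw [shiftMap_iterate_apply, shiftMap_iterate_apply]
    exact h _ (by omega) (by push_cast at *; omega)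
  rw [partEnt_word hσ] at h2
  have h3 := wordEnt_le_mul hσ (2 * M + 1 + (2 * M + 1))
  have h4 := entropyPart_mul_le μ (shiftMap A) α (2 * M + 1)
  have h0 : 0 ≤ wordEnt μ 1 := partEnt_nonneg _
  push_cast at *
  have hpos : (0 : ℝ) < 2 * M + 1 + 1 := by positivity
  refine le_of_mul_le_mul_right ?_ hpos
  nlinarith

lemma iInf_letterEnt_le_metricEntropy (hσ : MeasurePreserving (shiftMap A) μ μ) :
    ⨅ n, letterEnt μ n ≤ metricEntropy μ (shiftMap A) := by
  set e := Fintype.equivFin A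
  have hα : Measurable fun x : ℤ → A => e (x 0) :=
    (measurable_of_countable e).comp (measurable_pi_apply 0)
  refine le_trans ?_ (le_ciSup (bddAbove_entropyPart_shiftMap hσ) ⟨⟨_, fun x => e (x 0)⟩, hα⟩)
  refine le_ciInf fun n => (le_div_iff₀ (by positivity)).2 ?_
  have h1 := le_wordEnt_add (μ := μ) 0 (n + 1)
  have h0 : 0 ≤ wordEnt μ 0 := partEnt_nonneg _
  have h2 : wordEnt μ (n + 1) ≤
      partEnt μ (fun x (i : Fin (n + 1)) => e ((shiftMap A)^[(i : ℕ)] x 0)) := by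
    refine partEnt_le_of_factors (measurable_pi_lambda _ fun i =>
      hα.comp (hσ.measurable.iterate i)) fun x y h => funext fun i => ?_
    have := e.injective (congrFun h i)
    rwa [shiftMap_iterate_apply, shiftMap_iterate_apply] at this
  push_cast at h1
  rw [zero_add] at h1
  linarith

end Shift

/-! ### Lyapunov exponents -/

/-- The coordinates of `x` in `S` determine, within `X`, the coordinates in `T` of the first `n`
iterates. -/
def Determines {A : Type*} (X : Set (ℤ → A)) (F : (ℤ → A) → (ℤ → A)) (n : ℕ) (S T : Set ℤ)
    (x : ℤ → A) : Prop :=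
  ∀ i : ℕ, 1 ≤ i → i ≤ n → ∀ y ∈ X, (∀ k ∈ S, y k = x k) → ∀ k ∈ T, F^[i] y k = F^[i] x k

lemma measurableSet_determines {A : Type*} [Fintype A] [TopologicalSpace A] [DiscreteTopology A]
    [MeasurableSpace A] [BorelSpace A] {X : Set (ℤ → A)} (hX : IsClosed X)
    {F : (ℤ → A) → (ℤ → A)} (hF : Continuous F) (n : ℕ) (S T : Set ℤ) :
    MeasurableSet {x | Determines X F n S T x} := by
  have e : {x | Determines X F n S T x} = ⋂ (i : ℕ) (_ : 1 ≤ i) (_ : i ≤ n) (k : ℤ) (_ : k ∈ T),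
      (Prod.fst '' ({q : (ℤ → A) × (ℤ → A) | q.2 ∈ X} ∩ {q | ∀ k ∈ S, q.2 k = q.1 k} ∩
        {q | F^[i] q.2 k ≠ F^[i] q.1 k}))ᶜ := by
    ext x
    simp only [Determines, mem_ofPred_eq, mem_iInter, mem_compl_iff, mem_image, mem_inter_iff,
      Prod.exists, exists_and_right, exists_eq_right, not_exists, not_and, ne_eq, not_not]
    exact ⟨fun h i h1 h2 k hk y hy => h i h1 h2 y hy.1 hy.2 k hk,
      fun h i h1 h2 y hy hyS k hk => h i h1 h2 k hk y ⟨hy, hyS⟩⟩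
  rw [e]
  refine MeasurableSet.iInter fun i => MeasurableSet.iInter fun _ => MeasurableSet.iInter fun _ =>
    MeasurableSet.iInter fun k => MeasurableSet.iInter fun _ => MeasurableSet.compl ?_
  refine (IsCompact.image (IsClosed.isCompact ?_) continuous_fst).isClosed.measurableSet
  refine ((hX.preimage continuous_snd).inter ?_).inter ?_
  · simp only [ofPred_forall]
    exact isClosed_iInter fun k => isClosed_iInter fun _ => isClosed_eq
      ((continuous_apply k).comp continuous_snd) ((continuous_apply k).comp continuous_fst)
  · have hc : Continuous fun x => F^[i] x k := (continuous_apply k).comp (hF.iterate i)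
    exact (isClosed_discrete {q : A × A | q.1 ≠ q.2}).preimage
      ((hc.comp continuous_snd).prodMk (hc.comp continuous_fst))

lemma iterate_apply_eq_of_localRule {A : Type*} {F : (ℤ → A) → (ℤ → A)} {r : ℕ}
    (h : HasLocalRule F r) (i : ℕ) {x y : ℤ → A} {k : ℤ}
    (hxy : ∀ j, k - (r * i : ℕ) ≤ j → j ≤ k + (r * i : ℕ) → x j = y j) :
    F^[i] x k = F^[i] y k := by
  obtain ⟨f, hf⟩ := h
  induction i generalizing k with
  | zero => exact hxy k (by simp) (by simp)
  | succ i ih =>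
    rw [Function.iterate_succ_apply', Function.iterate_succ_apply', hf, hf]
    congr 1
    funext j
    refine ih fun l hl hl' => hxy l ?_ ?_
    · rw [Nat.mul_succ]; push_cast at *; omega
    · rw [Nat.mul_succ]; push_cast at *; omega

lemma iterate_shiftIter_of_localRule {A : Type*} {F : (ℤ → A) → (ℤ → A)} {r : ℕ}
    (h : HasLocalRule F r) (i : ℕ) (a : ℤ) (x : ℤ → A) :
    F^[i] (shiftIter a x) = shiftIter a (F^[i] x) := by
  obtain ⟨f, hf⟩ := h
  have hc : Function.Commute F (shiftIter a) := fun x => by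
    funext k
    simp only [shiftIter, hf]
    congr 1
    funext j
    congr 1
    ring
  exact (hc.iterate_left i) x

section Lyapunov

variable {A : Type*} {X : Set (ℤ → A)} {F : (ℤ → A) → (ℤ → A)} {r : ℕ}

lemma lamTildeP_le_iff (hFX : MapsTo F X X) (hloc : HasLocalRule F r) (n s : ℕ) (x : ℤ → A) :
    lamTildeP X F n x ≤ s ↔ Determines X F n (Ici 0) (Ici (s : ℤ)) x := by
  have hiff : ∀ s : ℕ, (∀ i : ℕ, 1 ≤ i → i ≤ n →
      F^[i] '' Wplus X 0 x ⊆ Wplus X (s : ℤ) (F^[i] x)) ↔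
      Determines X F n (Ici 0) (Ici (s : ℤ)) x := fun s => by
    refine forall_congr' fun i => forall_congr' fun _ => forall_congr' fun _ => ?_
    rw [image_subset_iff]
    exact ⟨fun h y hy hyx k hk => (h ⟨hy, hyx⟩).2 k hk,
      fun h y hy => ⟨hFX.iterate i hy.1, h y hy.1 hy.2⟩⟩
  unfold lamTildeP
  simp only [hiff]
  have hne : {s : ℕ | Determines X F n (Ici 0) (Ici (s : ℤ)) x}.Nonempty := by
    refine ⟨r * n, fun i _ hi y _ hyx k hk => iterate_apply_eq_of_localRule hloc i fun j hj _ => ?_⟩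
    have := Nat.mul_le_mul_left r hi
    simp only [mem_Ici] at hk hyx
    exact hyx j (by omega)
  refine ⟨fun h i h1 h2 y hy hyx k hk => ?_, fun h => Nat.sInf_le h⟩
  exact Nat.sInf_mem hne i h1 h2 y hy hyx k
    (le_trans (Int.ofNat_le.2 h) hk)

lemma lamTildeM_le_iff (hFX : MapsTo F X X) (hloc : HasLocalRule F r) (n s : ℕ) (x : ℤ → A) :
    lamTildeM X F n x ≤ s ↔ Determines X F n (Iic 0) (Iic (-(s : ℤ))) x := by
  have hiff : ∀ s : ℕ, (∀ i : ℕ, 1 ≤ i → i ≤ n →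
      F^[i] '' Wminus X 0 x ⊆ Wminus X (-(s : ℤ)) (F^[i] x)) ↔
      Determines X F n (Iic 0) (Iic (-(s : ℤ))) x := fun s => by
    refine forall_congr' fun i => forall_congr' fun _ => forall_congr' fun _ => ?_
    rw [image_subset_iff]
    exact ⟨fun h y hy hyx k hk => (h ⟨hy, hyx⟩).2 k hk,
      fun h y hy => ⟨hFX.iterate i hy.1, h y hy.1 hy.2⟩⟩
  unfold lamTildeM
  simp only [hiff]
  have hne : {s : ℕ | Determines X F n (Iic 0) (Iic (-(s : ℤ))) x}.Nonempty := by
    refine ⟨r * n, fun i _ hi y _ hyx k hk => iterate_apply_eq_of_localRule hloc i fun j _ hj => ?_⟩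
    have := Nat.mul_le_mul_left r hi
    simp only [mem_Iic] at hk hyx
    exact hyx j (by omega)
  refine ⟨fun h i h1 h2 y hy hyx k hk => ?_, fun h => Nat.sInf_le h⟩
  exact Nat.sInf_mem hne i h1 h2 y hy hyx k
    (le_trans hk (neg_le_neg (Int.ofNat_le.2 h)))

lemma lamTildeP_le (hFX : MapsTo F X X) (hloc : HasLocalRule F r) (n : ℕ) (x : ℤ → A) :
    lamTildeP X F n x ≤ r * n := by
  refine (lamTildeP_le_iff hFX hloc n _ x).2 fun i _ hi y _ hyx k hk =>
    iterate_apply_eq_of_localRule hloc i fun j hj _ => ?_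
  have := Nat.mul_le_mul_left r hi
  simp only [mem_Ici] at hk hyx
  exact hyx j (by omega)

lemma lamTildeM_le (hFX : MapsTo F X X) (hloc : HasLocalRule F r) (n : ℕ) (x : ℤ → A) :
    lamTildeM X F n x ≤ r * n := by
  refine (lamTildeM_le_iff hFX hloc n _ x).2 fun i _ hi y _ hyx k hk =>
    iterate_apply_eq_of_localRule hloc i fun j _ hj => ?_
  have := Nat.mul_le_mul_left r hi
  simp only [mem_Iic] at hk hyx
  exact hyx j (by omega)

/-- The supremum of a bounded measurable function over shift orbits is almost surely constant. -/
lemma exists_ae_sSup_shiftIter_eq [MeasurableSpace A] {μ : Measure (ℤ → A)}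
    (herg : Ergodic (shiftMap A) μ) {f : (ℤ → A) → ℕ} (hf : Measurable f) {B : ℕ}
    (hB : ∀ x, f x ≤ B) :
    Measurable (fun x => sSup (range fun j : ℤ => f (shiftIter j x))) ∧
      ∃ c, ∀ᵐ x ∂μ, sSup (range fun j : ℤ => f (shiftIter j x)) = c := by
  have hbdd : ∀ x, BddAbove (range fun j : ℤ => f (shiftIter j x)) := fun x =>
    ⟨B, by rintro _ ⟨j, rfl⟩; exact hB _⟩
  have hm : Measurable (fun x => sSup (range fun j : ℤ => f (shiftIter j x))) := by
    refine measurable_of_Iic fun s => ?_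
    have : (fun x => sSup (range fun j : ℤ => f (shiftIter j x))) ⁻¹' Iic s =
        ⋂ j : ℤ, (fun x => f (shiftIter j x)) ⁻¹' Iic s := by
      ext x
      simp only [mem_preimage, mem_Iic, mem_iInter]
      rw [csSup_le_iff (hbdd x) (range_nonempty _), forall_mem_range]
    rw [this]
    refine MeasurableSet.iInter fun j => ?_
    have hj : Measurable (shiftIter (A := A) j) :=
      measurable_pi_lambda _ fun i => measurable_pi_apply _
    exact (hf.comp hj) measurableSet_Iic
  refine ⟨hm, ?_⟩
  refine herg.toPreErgodic.ae_eq_const_of_ae_eq_comp hm (funext fun x => ?_)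
  have : (fun j : ℤ => f (shiftIter j (shiftMap A x))) =
      (fun j : ℤ => f (shiftIter j x)) ∘ Equiv.addRight 1 := by
    funext j
    simp only [Function.comp, Equiv.coe_addRight]
    congr 1
    funext i
    simp only [shiftIter, shiftMap, add_assoc]
  simp only [Function.comp_def] at this ⊢
  rw [this]
  exact congrArg sSup ((Equiv.addRight (1 : ℤ)).surjective.range_comp
    (fun j : ℤ => f (shiftIter j x)))

variable [Fintype A] [TopologicalSpace A] [DiscreteTopology A] [MeasurableSpace A] [BorelSpace A]

lemma measurable_lamTildeP (hX : IsClosed X) (hF : Continuous F) (hFX : MapsTo F X X)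
    (hloc : HasLocalRule F r) (n : ℕ) : Measurable (lamTildeP X F n) := by
  refine measurable_of_Iic fun s => ?_
  simp only [preimage, mem_Iic, lamTildeP_le_iff hFX hloc]
  exact measurableSet_determines hX hF _ _ _

lemma measurable_lamTildeM (hX : IsClosed X) (hF : Continuous F) (hFX : MapsTo F X X)
    (hloc : HasLocalRule F r) (n : ℕ) : Measurable (lamTildeM X F n) := by
  refine measurable_of_Iic fun s => ?_
  simp only [preimage, mem_Iic, lamTildeM_le_iff hFX hloc]
  exact measurableSet_determines hX hF _ _ _

end Lyapunov

lemma lamTildeP_shiftIter_le_lamP {A : Type*} {X : Set (ℤ → A)} {F : (ℤ → A) → (ℤ → A)} {r : ℕ}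
    (hFX : MapsTo F X X) (hloc : HasLocalRule F r) (n : ℕ) (x : ℤ → A) (j : ℤ) :
    lamTildeP X F n (shiftIter j x) ≤ lamP X F n x :=
  le_csSup ⟨r * n, by rintro _ ⟨j, rfl⟩; exact lamTildeP_le hFX hloc n _⟩ ⟨j, rfl⟩

lemma lamTildeM_shiftIter_le_lamM {A : Type*} {X : Set (ℤ → A)} {F : (ℤ → A) → (ℤ → A)} {r : ℕ}
    (hFX : MapsTo F X X) (hloc : HasLocalRule F r) (n : ℕ) (x : ℤ → A) (j : ℤ) :
    lamTildeM X F n (shiftIter j x) ≤ lamM X F n x :=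
  le_csSup ⟨r * n, by rintro _ ⟨j, rfl⟩; exact lamTildeM_le hFX hloc n _⟩ ⟨j, rfl⟩

lemma shiftIter_mem {A : Type*} {X : Set (ℤ → A)} (hX : shiftMap A '' X = X) {x : ℤ → A}
    (hx : x ∈ X) (j : ℤ) : shiftIter j x ∈ X := by
  induction j using Int.induction_on with
  | zero =>
    convert hx using 1
    funext k
    simp only [shiftIter, add_zero]
  | succ i ih =>
    rw [← hX]
    refine ⟨_, ih, funext fun k => ?_⟩
    simp only [shiftMap, shiftIter]
    congr 1
    ring
  | pred i ih =>
    rw [← hX] at ih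
    obtain ⟨y, hy, hyx⟩ := ih
    convert hy using 1
    funext k
    have := congrFun hyx (k - 1)
    simp only [shiftMap, shiftIter, sub_add_cancel] at this ⊢
    rw [this]
    congr 1
    ring

lemma ae_mem_of_msupp_subset {A : Type*} [Fintype A] [TopologicalSpace A] [DiscreteTopology A]
    [MeasurableSpace A] {μ : Measure (ℤ → A)} {X : Set (ℤ → A)} (h : msupp μ ⊆ X) :
    ∀ᵐ x ∂μ, x ∈ X := by
  refine measure_null_of_locally_null _ fun x hx => ?_
  have hx' : x ∉ msupp μ := fun h' => hx (h h')
  simp only [msupp, mem_ofPred_eq, not_forall, not_lt, nonpos_iff_eq_zero] at hx'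
  obtain ⟨U, hU, hxU, hμ⟩ := hx'
  exact ⟨U, mem_nhdsWithin_of_mem_nhds (hU.mem_nhds hxU), hμ⟩

/-- Entropy bound for the orbit of a central word, in terms of the almost sure values of `Λₙ^±`. -/
lemma partEnt_orbit_word_le {A : Type*} [Fintype A] [TopologicalSpace A] [DiscreteTopology A]
    [MeasurableSpace A] [BorelSpace A] {X : Set (ℤ → A)} (hXcl : IsClosed X)
    (hXσ : shiftMap A '' X = X) {F : (ℤ → A) → (ℤ → A)} (hFX : MapsTo F X X) (hFc : Continuous F)
    {r : ℕ} (hloc : HasLocalRule F r) {μ : Measure (ℤ → A)} [IsProbabilityMeasure μ]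
    (hσ : MeasurePreserving (shiftMap A) μ μ) (hX1 : ∀ᵐ x ∂μ, x ∈ X) {n cp cm : ℕ}
    (hmp : Measurable (lamP X F n)) (hmm : Measurable (lamM X F n))
    (hcp : ∀ᵐ x ∂μ, lamP X F n x = cp) (hcm : ∀ᵐ x ∂μ, lamM X F n x = cm) (p : ℕ) :
    partEnt μ (fun x (i : Fin (n + 1)) => word (-(p : ℤ)) (2 * p + 1) (F^[(i : ℕ)] x)) ≤
      wordEnt μ (2 * p + 1) + (cp + cm) * letterEnt μ (2 * p + 1) +
        2 * (r * n) * (letterEnt μ (2 * p + 1) - ⨅ n, letterEnt μ n) + 2 := by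
  set G : Set (ℤ → A) := (X ∩ lamP X F n ⁻¹' {cp}) ∩ lamM X F n ⁻¹' {cm} with hG
  have hGm : MeasurableSet G := (hXcl.measurableSet.inter (hmp (measurableSet_singleton _))).inter
    (hmm (measurableSet_singleton _))
  have hG1 : ∀ᵐ x ∂μ, x ∈ G := by
    filter_upwards [hX1, hcp, hcm] with x h1 h2 h3 using ⟨⟨h1, h2⟩, h3⟩
  have hY : Measurable fun x (i : Fin (n + 1)) =>
      word (-(p : ℤ)) (2 * p + 1) (F^[(i : ℕ)] x) :=
    measurable_pi_lambda _ fun i => (measurable_word _ _).comp (hFc.iterate i).measurable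
  have hright : ∀ x ∈ G, ∀ y ∈ G, ∀ a : ℤ, (∀ k, a ≤ k → x k = y k) →
      ∀ i ≤ n, ∀ k, a + cp ≤ k → F^[i] x k = F^[i] y k := by
    intro x hx y hy a hxy i hi k hk
    rcases Nat.eq_zero_or_pos i with rfl | hi0
    · exact hxy k (by omega)
    have hle : lamTildeP X F n (shiftIter a y) ≤ cp :=
      (lamTildeP_shiftIter_le_lamP hFX hloc n y a).trans hy.1.2.le
    have := (lamTildeP_le_iff hFX hloc n cp _).1 hle i hi0 hi _ (shiftIter_mem hXσ hx.1.1 a)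
      (fun k hk => hxy _ (by simp only [mem_Ici] at hk; omega)) (k - a)
      (by simp only [mem_Ici]; omega)
    simpa [iterate_shiftIter_of_localRule hloc, shiftIter] using this
  have hleft : ∀ x ∈ G, ∀ y ∈ G, ∀ a : ℤ, (∀ k, k ≤ a → x k = y k) →
      ∀ i ≤ n, ∀ k, k ≤ a - cm → F^[i] x k = F^[i] y k := by
    intro x hx y hy a hxy i hi k hk
    rcases Nat.eq_zero_or_pos i with rfl | hi0
    · exact hxy k (by omega)
    have hle : lamTildeM X F n (shiftIter a y) ≤ cm :=
      (lamTildeM_shiftIter_le_lamM hFX hloc n y a).trans hy.2.le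
    have := (lamTildeM_le_iff hFX hloc n cm _).1 hle i hi0 hi _ (shiftIter_mem hXσ hx.1.1 a)
      (fun k hk => hxy _ (by simp only [mem_Iic] at hk; omega)) (k - a)
      (by simp only [mem_Iic]; omega)
    simpa [iterate_shiftIter_of_localRule hloc, shiftIter] using this
  have h := partEnt_le_of_two_sided hσ hY hGm hG1 (-(p : ℤ) - cp) (2 * p + 1 + (cp + cm)) (r * n)
    (fun x hx y hy hxy => funext fun i => word_eq_iff.2 fun k hk _ =>
      hright x hx y hy _ hxy i (by omega) k (by omega))
    (fun x hx y hy hxy => funext fun i => word_eq_iff.2 fun k _ hk =>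
      hleft x hx y hy (p + cm) (fun k hk => hxy k (by push_cast; omega)) i (by omega) k
        (by push_cast at hk; omega))
    (fun x y hxy => funext fun i => word_eq_iff.2 fun k hk hk' =>
      iterate_apply_eq_of_localRule hloc i fun j hj hj' => by
        have := Nat.mul_le_mul_left r (Nat.lt_succ_iff.1 i.2)
        exact hxy j (by omega) (by push_cast at hk' ⊢; zify at this; push_cast at hj'; omega))
    one_pos
  have h1 := wordEnt_add_le hσ (2 * p + 1) (cp + cm)
  have h2 := mul_le_mul_of_nonneg_left (antitone_letterEnt hσ
    (Nat.le_add_right (2 * p + 1) (cp + cm))) (by positivity : (0 : ℝ) ≤ r * n)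
  push_cast at h h1
  linarith

/-- Corollary: for a `σ`-ergodic and `F`-invariant measure `μ`,
`h_μ(F) ≤ h_μ(σ) · (λ_μ⁺ + λ_μ⁻)`. -/
theorem stmt12 {A : Type*} [Fintype A] [TopologicalSpace A] [DiscreteTopology A]
    [MeasurableSpace A] [BorelSpace A]
    (X : Set (ℤ → A)) (hXcl : IsClosed X) (hXσ : shiftMap A '' X = X)
    (F : (ℤ → A) → (ℤ → A)) (hFX : Set.MapsTo F X X) (hFc : Continuous F)
    (hFσ : ∀ x, F (shiftMap A x) = shiftMap A (F x))
    (r : ℕ) (hr : 1 ≤ r) (hloc : HasLocalRule F r)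
    (μ : Measure (ℤ → A)) [IsProbabilityMeasure μ]
    (herg : Ergodic (shiftMap A) μ) (hFinv : MeasurePreserving F μ μ)
    (hsuppX : msupp μ ⊆ X)
    (lp lm : ℝ)
    (hlp : ∀ᵐ x ∂μ, Filter.Tendsto (fun n : ℕ => (lamP X F n x : ℝ) / n)
      Filter.atTop (nhds lp))
    (hlm : ∀ᵐ x ∂μ, Filter.Tendsto (fun n : ℕ => (lamM X F n x : ℝ) / n)
      Filter.atTop (nhds lm)) :
    metricEntropy μ F ≤ metricEntropy μ (shiftMap A) * (lp + lm) := by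
  have hσ := herg.toMeasurePreserving
  have hP : ∀ n, Measurable (lamP X F n) ∧ ∃ c, ∀ᵐ x ∂μ, lamP X F n x = c := fun n =>
    exists_ae_sSup_shiftIter_eq herg (measurable_lamTildeP hXcl hFc hFX hloc n)
      (lamTildeP_le hFX hloc n)
  have hM : ∀ n, Measurable (lamM X F n) ∧ ∃ c, ∀ᵐ x ∂μ, lamM X F n x = c := fun n =>
    exists_ae_sSup_shiftIter_eq herg (measurable_lamTildeM hXcl hFc hFX hloc n)
      (lamTildeM_le hFX hloc n)
  choose hmp cp hcp using hP
  choose hmm cm hcm using hM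
  have htp : Tendsto (fun n : ℕ => (cp n : ℝ) / n) atTop (𝓝 lp) := by
    obtain ⟨x, hx, hx'⟩ := (hlp.and (ae_all_iff.2 hcp)).exists
    simpa only [hx'] using hx
  have htm : Tendsto (fun n : ℕ => (cm n : ℝ) / n) atTop (𝓝 lm) := by
    obtain ⟨x, hx, hx'⟩ := (hlm.and (ae_all_iff.2 hcm)).exists
    simpa only [hx'] using hx
  have hlp0 : 0 ≤ lp := ge_of_tendsto' htp fun n => by positivity
  have hlm0 : 0 ≤ lm := ge_of_tendsto' htm fun n => by positivity
  set h : ℝ := ⨅ n, letterEnt μ n with hh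
  have hlim : Tendsto (letterEnt μ) atTop (𝓝 h) :=
    tendsto_atTop_ciInf (antitone_letterEnt hσ) bddBelow_letterEnt
  have key : ∀ (k : ℕ) (α : (ℤ → A) → Fin k), Measurable α → ∀ ε : ℝ, 0 < ε →
      entropyPart μ F α ≤ (lp + lm) * (h + ε) + 2 * r * ε + ε := by
    intro k α hα ε hε
    obtain ⟨M, hM⟩ := exists_partEnt_word_le_add (μ := μ) hα hε
    obtain ⟨p₀, hp₀⟩ := eventually_atTop.1 (hlim.eventually (eventually_le_nhds
      (lt_add_of_pos_right h hε)))
    set p := max M p₀ with hp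
    have hd : letterEnt μ (2 * p + 1) ≤ h + ε :=
      hp₀ _ (by have := le_max_right M p₀; omega)
    have bound : ∀ n : ℕ, 1 ≤ n → entropyPart μ F α * (1 + 1 / (n : ℝ)) ≤
        (wordEnt μ (2 * p + 1) + 2) / n + ((cp n : ℝ) / n + (cm n : ℝ) / n) * (h + ε) +
          2 * r * ε + (1 + 1 / (n : ℝ)) * ε := by
      intro n hn
      have h1 := entropyPart_mul_le μ F α n
      have h2 := partEnt_orbit_le hFinv hα (measurable_word _ _) (hM p (le_max_left _ _)) (n + 1)
      have h3 := partEnt_orbit_word_le hXcl hXσ hFX hFc hloc hσ (ae_mem_of_msupp_subset hsuppX)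
        (hmp n) (hmm n) (hcp n) (hcm n) p
      have h4 := mul_le_mul_of_nonneg_left hd (by positivity : (0 : ℝ) ≤ cp n + cm n)
      have h5 := mul_le_mul_of_nonneg_left (sub_le_iff_le_add'.2 hd)
        (by positivity : (0 : ℝ) ≤ 2 * (r * n))
      push_cast at h2
      have hn0 : (0 : ℝ) < n := by exact_mod_cast hn
      refine le_of_mul_le_mul_right ?_ hn0
      have e1 : entropyPart μ F α * (1 + 1 / (n : ℝ)) * n = entropyPart μ F α * (n + 1) := by
        field_simp
      have e2 : ((wordEnt μ (2 * p + 1) + 2) / n + ((cp n : ℝ) / n + (cm n : ℝ) / n) * (h + ε) +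
          2 * r * ε + (1 + 1 / (n : ℝ)) * ε) * n = wordEnt μ (2 * p + 1) + 2 +
          (cp n + cm n) * (h + ε) + 2 * (r * n) * ε + (n + 1) * ε := by
        field_simp
      rw [e1, e2]
      linarith
    have t1 : Tendsto (fun n : ℕ => 1 + 1 / (n : ℝ)) atTop (𝓝 1) := by
      simpa using tendsto_one_div_atTop_nhds_zero_nat.const_add (1 : ℝ)
    have t2 := t1.const_mul (entropyPart μ F α)
    have t3 := ((((tendsto_const_div_atTop_nhds_zero_nat (wordEnt μ (2 * p + 1) + 2)).add
      ((htp.add htm).mul_const (h + ε))).add_const (2 * r * ε)).add (t1.mul_const ε))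
    have := le_of_tendsto_of_tendsto t2 t3 (eventually_atTop.2 ⟨1, bound⟩)
    linarith
  have : Nonempty {q : Σ k : ℕ, (ℤ → A) → Fin k // Measurable q.2} :=
    ⟨⟨⟨1, fun _ => 0⟩, measurable_const⟩⟩
  refine (ciSup_le fun q => ?_ : metricEntropy μ F ≤ h * (lp + lm)).trans
    (mul_le_mul_of_nonneg_right (iInf_letterEnt_le_metricEntropy hσ) (by positivity))
  refine le_of_forall_pos_le_add fun η hη => ?_
  have hpos : 0 < lp + lm + 2 * r + 1 := by positivity
  have hq := key _ q.1.2 q.2 (η / (lp + lm + 2 * r + 1)) (by positivity)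
  have e : η / (lp + lm + 2 * r + 1) * (lp + lm + 2 * r + 1) = η := div_mul_cancel₀ _ hpos.ne'
  linarith
end

section
/- Let F : A^ℤ → A^ℤ be an onto cellular automaton and μ_u the uniform Bernoulli measure on A^ℤ. Then the topological entropy of F satisfies h_top(F) ≤ (λ_{μ_u}⁺ + λ_{μ_u}⁻) · log #A. -/
open MeasureTheory Filter Topology Set

/-- The coordinate `F^n(x)_c` depends only on the coordinates of `x` within distance `r * n`
of `c`. -/
theorem HasLocalRule.iterate_congr {A : Type*} {F : (ℤ → A) → (ℤ → A)} {r : ℕ}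
    (hloc : HasLocalRule F r) (n : ℕ) (x y : ℤ → A) (c : ℤ)
    (h : ∀ i, c - r * n ≤ i → i ≤ c + r * n → x i = y i) : F^[n] x c = F^[n] y c := by
  induction n generalizing c with
  | zero => exact h c (by simp) (by simp)
  | succ n ih =>
    obtain ⟨f, hf⟩ := hloc
    rw [Function.iterate_succ_apply', Function.iterate_succ_apply', hf, hf]
    congr 1
    funext j
    have hj := j.isLt
    refine ih _ fun i hi hi' => h i ?_ ?_ <;> push_cast <;> lia

theorem HasLocalRule.iterate_shiftIter {A : Type*} {F : (ℤ → A) → (ℤ → A)} {r : ℕ}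
    (hloc : HasLocalRule F r) (j : ℤ) (n : ℕ) (x : ℤ → A) :
    F^[n] (shiftIter j x) = shiftIter j (F^[n] x) := by
  obtain ⟨f, hf⟩ := hloc
  have hcomm : Function.Commute F (shiftIter j) := fun x => by
    funext i
    simp only [hf, shiftIter]
    congr 1
    funext k
    congr 1
    ring
  exact hcomm.iterate_left n x

/-- The set defining `lamTildeP` contains `r * n`. -/
theorem HasLocalRule.mul_mem_lamTildeP {A : Type*} {F : (ℤ → A) → (ℤ → A)} {r : ℕ}
    (hloc : HasLocalRule F r) (n : ℕ) (x : ℤ → A) :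
    r * n ∈ {s : ℕ | ∀ i : ℕ, 1 ≤ i → i ≤ n →
      F^[i] '' Wplus univ 0 x ⊆ Wplus univ (s : ℤ) (F^[i] x)} := by
  rintro i - hin _ ⟨y, ⟨-, hy⟩, rfl⟩
  refine ⟨mem_univ _, fun c hc => hloc.iterate_congr i y x c fun k hk _ => hy k ?_⟩
  have h : (r : ℤ) * i ≤ r * n := by gcongr
  push_cast at hc
  lia

/-- The set defining `lamTildeM` contains `r * n`. -/
theorem HasLocalRule.mul_mem_lamTildeM {A : Type*} {F : (ℤ → A) → (ℤ → A)} {r : ℕ}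
    (hloc : HasLocalRule F r) (n : ℕ) (x : ℤ → A) :
    r * n ∈ {s : ℕ | ∀ i : ℕ, 1 ≤ i → i ≤ n →
      F^[i] '' Wminus univ 0 x ⊆ Wminus univ (-(s : ℤ)) (F^[i] x)} := by
  rintro i - hin _ ⟨y, ⟨-, hy⟩, rfl⟩
  refine ⟨mem_univ _, fun c hc => hloc.iterate_congr i y x c fun k _ hk => hy k ?_⟩
  have h : (r : ℤ) * i ≤ r * n := by gcongr
  push_cast at hc
  lia

/-- If the shift orbit of `x` is dense, then `lamP` at `x` bounds the rightward propagation of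
perturbations for all configurations. -/
theorem HasLocalRule.iterate_eq_of_agree_right {A : Type*} {F : (ℤ → A) → (ℤ → A)} {r : ℕ}
    (hloc : HasLocalRule F r) {x : ℤ → A}
    (hx : ∀ (N : ℕ) (y : ℤ → A), ∃ j : ℤ, ∀ i : ℤ, |i| ≤ N → shiftIter j x i = y i)
    {n i : ℕ} (hin : i ≤ n) (a : ℤ) {y z : ℤ → A} (hyz : ∀ k, a ≤ k → y k = z k)
    {c : ℤ} (hc : a + lamP univ F n x ≤ c) : F^[i] y c = F^[i] z c := by
  wlog ha : a = 0 generalizing a y z c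
  · have h := this 0 (y := shiftIter a y) (z := shiftIter a z)
      (fun k hk => hyz (k + a) (by lia)) (c := c - a) (by lia) rfl
    simpa [hloc.iterate_shiftIter, shiftIter] using h
  subst ha
  obtain rfl | hi := Nat.eq_zero_or_pos i
  · exact hyz c (by lia)
  obtain ⟨j, hj⟩ := hx (c.natAbs + r * i) y
  set x' := shiftIter j x
  let z' : ℤ → A := fun k => if k < 0 then z k else x' k
  have hle : lamTildeP univ F n x' ≤ lamP univ F n x :=
    le_csSup ⟨r * n, by rintro _ ⟨k, rfl⟩; exact Nat.sInf_le (hloc.mul_mem_lamTildeP n _)⟩ ⟨j, rfl⟩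
  have hmem := Nat.sInf_mem ⟨_, hloc.mul_mem_lamTildeP n x'⟩ i hi hin
  have hz' : F^[i] z' c = F^[i] x' c :=
    (hmem ⟨z', ⟨mem_univ _, fun k hk => if_neg (by lia)⟩, rfl⟩).2 c (by
      change (lamTildeP univ F n x' : ℤ) ≤ c
      lia)
  have hwin : ∀ k : ℤ, c - r * i ≤ k → k ≤ c + r * i → |k| ≤ ((c.natAbs + r * i : ℕ) : ℤ) := by
    intro k h₁ h₂
    rw [Nat.cast_add, Nat.cast_mul, abs_le]
    constructor <;> lia
  calc F^[i] y c = F^[i] x' c :=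
        hloc.iterate_congr i y x' c fun k h₁ h₂ => (hj k (hwin k h₁ h₂)).symm
    _ = F^[i] z' c := hz'.symm
    _ = F^[i] z c := hloc.iterate_congr i z' z c fun k h₁ h₂ => by
        by_cases hk : k < 0
        · exact if_pos hk
        · exact (if_neg hk).trans ((hj k (hwin k h₁ h₂)).trans (hyz k (by lia)))

/-- If the shift orbit of `x` is dense, then `lamM` at `x` bounds the leftward propagation of
perturbations for all configurations. -/
theorem HasLocalRule.iterate_eq_of_agree_left {A : Type*} {F : (ℤ → A) → (ℤ → A)} {r : ℕ}
    (hloc : HasLocalRule F r) {x : ℤ → A}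
    (hx : ∀ (N : ℕ) (y : ℤ → A), ∃ j : ℤ, ∀ i : ℤ, |i| ≤ N → shiftIter j x i = y i)
    {n i : ℕ} (hin : i ≤ n) (a : ℤ) {y z : ℤ → A} (hyz : ∀ k, k ≤ a → y k = z k)
    {c : ℤ} (hc : c ≤ a - lamM univ F n x) : F^[i] y c = F^[i] z c := by
  wlog ha : a = 0 generalizing a y z c
  · have h := this 0 (y := shiftIter a y) (z := shiftIter a z)
      (fun k hk => hyz (k + a) (by lia)) (c := c - a) (by lia) rfl
    simpa [hloc.iterate_shiftIter, shiftIter] using h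
  subst ha
  obtain rfl | hi := Nat.eq_zero_or_pos i
  · exact hyz c (by lia)
  obtain ⟨j, hj⟩ := hx (c.natAbs + r * i) y
  set x' := shiftIter j x
  let z' : ℤ → A := fun k => if 0 < k then z k else x' k
  have hle : lamTildeM univ F n x' ≤ lamM univ F n x :=
    le_csSup ⟨r * n, by rintro _ ⟨k, rfl⟩; exact Nat.sInf_le (hloc.mul_mem_lamTildeM n _)⟩ ⟨j, rfl⟩
  have hmem := Nat.sInf_mem ⟨_, hloc.mul_mem_lamTildeM n x'⟩ i hi hin
  have hz' : F^[i] z' c = F^[i] x' c :=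
    (hmem ⟨z', ⟨mem_univ _, fun k hk => if_neg (by lia)⟩, rfl⟩).2 c (by
      change c ≤ -(lamTildeM univ F n x' : ℤ)
      lia)
  have hwin : ∀ k : ℤ, c - r * i ≤ k → k ≤ c + r * i → |k| ≤ ((c.natAbs + r * i : ℕ) : ℤ) := by
    intro k h₁ h₂
    rw [Nat.cast_add, Nat.cast_mul, abs_le]
    constructor <;> lia
  calc F^[i] y c = F^[i] x' c :=
        hloc.iterate_congr i y x' c fun k h₁ h₂ => (hj k (hwin k h₁ h₂)).symm
    _ = F^[i] z' c := hz'.symm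
    _ = F^[i] z c := hloc.iterate_congr i z' z c fun k h₁ h₂ => by
        by_cases hk : 0 < k
        · exact if_pos hk
        · exact (if_neg hk).trans ((hj k (hwin k h₁ h₂)).trans (hyz k (by lia)))

/-- If the iterates `F^i`, `i ≤ n`, on `[-p, p]` are determined by the coordinates in `[a, b]`,
then the covering number is at most the number of words on `[a, b]`. -/
theorem coverNum_le_card_pow {A : Type*} [Fintype A] [Nonempty A] {F : (ℤ → A) → (ℤ → A)}
    {n p : ℕ} (a b : ℤ)
    (h : ∀ x y : ℤ → A, (∀ k, a ≤ k → k ≤ b → x k = y k) →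
      ∀ i : ℕ, i ≤ n → ∀ j : ℤ, |j| ≤ (p : ℤ) → F^[i] x j = F^[i] y j) :
    coverNum F n p ≤ Fintype.card A ^ (b + 1 - a).toNat := by
  classical
  inhabit A
  let e : (Finset.Icc a b → A) → ℤ → A := fun w k =>
    if hk : k ∈ Finset.Icc a b then w ⟨k, hk⟩ else default
  refine Nat.sInf_le ⟨Finset.univ.image e, Finset.card_image_le.trans ?_, fun x => ?_⟩
  · simp
  · refine ⟨e fun k => x k, Finset.mem_image_of_mem _ (Finset.mem_univ _), h _ _ fun k h₁ h₂ => ?_⟩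
    simp [e, h₁, h₂]

theorem iterate_shiftMap_apply {A : Type*} (n : ℕ) (x : ℤ → A) (i : ℤ) :
    (shiftMap A)^[n] x i = x (i + n) := by
  induction n generalizing i with
  | zero => simp
  | succ n ih =>
    rw [Function.iterate_succ_apply', shiftMap, ih]
    congr 1
    push_cast
    ring

/-- For an ergodic measure, almost every orbit visits a given set of positive measure. -/
theorem Ergodic.ae_exists_iterate_mem {Ω : Type*} [MeasurableSpace Ω] {μ : Measure Ω}
    [IsFiniteMeasure μ] {T : Ω → Ω} (hT : Ergodic T μ) {s : Set Ω} (hs : MeasurableSet s)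
    (hpos : μ s ≠ 0) : ∀ᵐ x ∂μ, ∃ n : ℕ, T^[n] x ∈ s := by
  have hmeas : MeasurableSet (⋃ n : ℕ, T^[n] ⁻¹' s) :=
    MeasurableSet.iUnion fun n => hT.measurable.iterate n hs
  have hsub : T ⁻¹' (⋃ n : ℕ, T^[n] ⁻¹' s) ⊆ ⋃ n : ℕ, T^[n] ⁻¹' s := by
    intro x hx
    obtain ⟨n, hn⟩ := mem_iUnion.1 hx
    exact mem_iUnion.2 ⟨n + 1, hn⟩
  rcases hT.ae_empty_or_univ_of_preimage_ae_le hmeas.nullMeasurableSet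
    (Eventually.of_forall hsub) with h | h
  · exact absurd (measure_mono_null (subset_iUnion (fun n : ℕ => T^[n] ⁻¹' s) 0)
      (ae_eq_empty.1 h)) hpos
  · filter_upwards [eventuallyEq_univ.1 h] with x hx
    exact mem_iUnion.1 hx

/-- Almost every configuration contains every word, for an ergodic measure charging every
cylinder. -/
theorem ae_dense_shift_orbit {A : Type*} [Fintype A] [MeasurableSpace A]
    [MeasurableSingletonClass A] (μ : Measure (ℤ → A)) [IsFiniteMeasure μ]
    (hpos : ∀ (t : ℤ) (k : ℕ) (u : Fin k → A),
      μ {x : ℤ → A | ∀ j : Fin k, x (t + ((j : ℕ) : ℤ)) = u j} ≠ 0)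
    (herg : Ergodic (shiftMap A) μ) :
    ∀ᵐ x ∂μ, ∀ (N : ℕ) (y : ℤ → A), ∃ j : ℤ, ∀ i : ℤ, |i| ≤ N → shiftIter j x i = y i := by
  have hword : ∀ᵐ x ∂μ, ∀ (N : ℕ) (u : Fin (2 * N + 1) → A), ∃ n : ℕ,
      (shiftMap A)^[n] x ∈
        {x : ℤ → A | ∀ j : Fin (2 * N + 1), x (-(N : ℤ) + ((j : ℕ) : ℤ)) = u j} := by
    refine ae_all_iff.2 fun N => ae_all_iff.2 fun u => herg.ae_exists_iterate_mem ?_ (hpos _ _ u)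
    rw [ofPred_forall]
    exact MeasurableSet.iInter fun j =>
      (measurableSet_singleton (u j)).preimage
        (measurable_pi_apply (X := fun _ : ℤ => A) (-(N : ℤ) + ((j : ℕ) : ℤ)))
  filter_upwards [hword] with x hx N y
  obtain ⟨n, hn⟩ := hx N fun j => y (-(N : ℤ) + ((j : ℕ) : ℤ))
  refine ⟨n, fun i hi => ?_⟩
  rw [abs_le] at hi
  have h := hn ⟨(i + N).toNat, by lia⟩
  have hcast : -(N : ℤ) + ((i + N).toNat : ℤ) = i := by lia
  simpa only [iterate_shiftMap_apply, hcast, shiftIter] using h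

/-- Topological inequality: for an onto cellular automaton `F` on the full shift
`A^ℤ` and the uniform Bernoulli measure `μ_u`,
`h_top(F) ≤ (λ_{μ_u}⁺ + λ_{μ_u}⁻) · log #A`. -/
theorem stmt13 {A : Type*} [Fintype A] [TopologicalSpace A] [DiscreteTopology A]
    [MeasurableSpace A] [BorelSpace A]
    (F : (ℤ → A) → (ℤ → A)) (hFc : Continuous F)
    (hFσ : ∀ x, F (shiftMap A x) = shiftMap A (F x))
    (r : ℕ) (hr : 1 ≤ r) (hloc : HasLocalRule F r)
    (hFonto : Function.Surjective F)
    (μ : Measure (ℤ → A)) [IsProbabilityMeasure μ]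
    (hμu : ∀ (t : ℤ) (k : ℕ) (u : Fin k → A),
      μ {x : ℤ → A | ∀ j : Fin k, x (t + ((j : ℕ) : ℤ)) = u j} =
        ((Fintype.card A : ENNReal))⁻¹ ^ k)
    (herg : Ergodic (shiftMap A) μ)
    (lp lm : ℝ)
    (hlp : ∀ᵐ x ∂μ, Filter.Tendsto
      (fun n : ℕ => (lamP (Set.univ) F n x : ℝ) / n) Filter.atTop (nhds lp))
    (hlm : ∀ᵐ x ∂μ, Filter.Tendsto
      (fun n : ℕ => (lamM (Set.univ) F n x : ℝ) / n) Filter.atTop (nhds lm)) :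
    htop F ≤ (lp + lm) * Real.log (Fintype.card A) := by
  have hpos : ∀ (t : ℤ) (k : ℕ) (u : Fin k → A),
      μ {x : ℤ → A | ∀ j : Fin k, x (t + ((j : ℕ) : ℤ)) = u j} ≠ 0 := fun t k u => by
    rw [hμu]
    exact pow_ne_zero _ (ENNReal.inv_ne_zero.2 (ENNReal.natCast_ne_top _))
  obtain ⟨x, hx, hxp, hxm⟩ := ((ae_dense_shift_orbit μ hpos herg).and (hlp.and hlm)).exists
  have : Nonempty A := ⟨x 0⟩
  have hcard : (1 : ℝ) ≤ Fintype.card A := by exact_mod_cast Fintype.card_pos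
  have hlog : 0 ≤ Real.log (Fintype.card A) := Real.log_nonneg hcard
  refine ciSup_le fun p => ?_
  have hcover : ∀ n : ℕ, coverNum F n p ≤
      Fintype.card A ^ (2 * p + 1 + lamP univ F n x + lamM univ F n x) := fun n => by
    have h := coverNum_le_card_pow (F := F) (n := n) (p := p) (-p - lamP univ F n x)
      (p + lamM univ F n x) fun y z hyz i hi j hj => by
        rw [abs_le] at hj
        let w : ℤ → A := fun k => if -p - (lamP univ F n x : ℤ) ≤ k then y k else z k
        calc F^[i] y j = F^[i] w j :=
              hloc.iterate_eq_of_agree_right hx hi (-p - lamP univ F n x)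
                (fun k hk => (if_pos hk).symm) (by lia)
          _ = F^[i] z j :=
              hloc.iterate_eq_of_agree_left hx hi (p + lamM univ F n x) (fun k hk => by
                by_cases hk' : -p - (lamP univ F n x : ℤ) ≤ k
                · exact (if_pos hk').trans (hyz k hk' hk)
                · exact if_neg hk') (by lia)
    convert h using 2
    lia
  have hbound : ∀ n : ℕ, Real.log (coverNum F n p) / n ≤
      ((2 * p + 1 : ℝ) / n + lamP univ F n x / n + lamM univ F n x / n) *
        Real.log (Fintype.card A) := fun n => by
    rw [← add_div, ← add_div, div_mul_eq_mul_div]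
    gcongr
    obtain h0 | h0 := Nat.eq_zero_or_pos (coverNum F n p)
    · rw [h0, Nat.cast_zero, Real.log_zero]
      positivity
    · refine (Real.log_le_log (by exact_mod_cast h0) (Nat.cast_le.2 (hcover n))).trans_eq ?_
      rw [Nat.cast_pow, Real.log_pow]
      push_cast
      rfl
  have hlim : Tendsto (fun n : ℕ =>
      ((2 * p + 1 : ℝ) / n + lamP univ F n x / n + lamM univ F n x / n) *
        Real.log (Fintype.card A)) atTop (𝓝 ((lp + lm) * Real.log (Fintype.card A))) := by
    simpa using (((tendsto_const_div_atTop_nhds_zero_nat (2 * p + 1 : ℝ)).add hxp).add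
      hxm).mul_const (Real.log (Fintype.card A))
  rw [← hlim.limsup_eq]
  exact limsup_le_limsup (Eventually.of_forall hbound)
    (isCoboundedUnder_le_of_le atTop (x := 0) fun n =>
      div_nonneg (Real.log_natCast_nonneg _) n.cast_nonneg) hlim.isBoundedUnder_le
end

section
/- Let F be the Coven cellular automaton on {0,1}^ℤ with radius 2 and local rule F(x)_i = x_i + 1 (mod 2) if (x_{i+1}, x_{i+2}) = (1,0), and F(x)_i = x_i otherwise. Let z ∈ {0,1}^ℤ be the point with z_0 = 0 and z_i = 1 for all i ≠ 0. Then for every n ≥ 1 one has F^n(z)_{-2n-2} = 1, F^n(z)_{-2n-1} = 1 and F^n(z)_{-2n} = 0. -/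
open MeasureTheory Filter Topology Set

/-- The Coven cellular automaton of radius 2 with aperiodic word `10`:
`F(x)_i = x_i + 1 (mod 2)` if `(x_{i+1}, x_{i+2}) = (1, 0)`, and
`F(x)_i = x_i` otherwise. -/
def covenF : (ℤ → Fin 2) → (ℤ → Fin 2) := fun x i =>
  if x (i + 1) = 1 ∧ x (i + 2) = 0 then x i + 1 else x i

/-- The point `z` with `z₀ = 0` and `z_i = 1` for `i ≠ 0`. -/
def covenZ : ℤ → Fin 2 := fun i => if i = 0 then 0 else 1

/-- `Fⁿ(z)` has its leftmost `0` at coordinate `-2n`. -/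
theorem covenF_iterate_covenZ_leftmost (n : ℕ) :
    (∀ i : ℤ, i < -(2 * (n : ℤ)) → covenF^[n] covenZ i = 1) ∧
    covenF^[n] covenZ (-(2 * (n : ℤ))) = 0 := by
  induction n with
  | zero =>
    refine ⟨fun i hi => ?_, ?_⟩
    · have h : i ≠ 0 := by push_cast at hi; omega
      simp [covenZ, h]
    · simp [covenZ]
  | succ n ih =>
    obtain ⟨h1, h0⟩ := ih
    rw [Function.iterate_succ_apply']
    push_cast
    refine ⟨fun i hi => ?_, ?_⟩
    · have h : covenF^[n] covenZ (i + 2) = 1 := h1 _ (by omega)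
      simp [covenF, h, h1 i (by omega)]
    · have ha : covenF^[n] covenZ (-(2 * ((n : ℤ) + 1)) + 1) = 1 := h1 _ (by omega)
      have hb : covenF^[n] covenZ (-(2 * ((n : ℤ) + 1)) + 2) = 0 := by
        rwa [show -(2 * ((n : ℤ) + 1)) + 2 = -(2 * (n : ℤ)) by ring]
      have hc : covenF^[n] covenZ (-(2 * ((n : ℤ) + 1))) = 1 := h1 _ (by omega)
      simp only [covenF, ha, hb, hc, and_self, if_true]
      rfl

/-- Propagation of the single perturbation `z` under the Coven automaton: for every
`n ≥ 1`, `Fⁿ(z)` carries the word `110` on the coordinates `(-2n-2, -2n-1, -2n)`. -/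
theorem stmt16 : ∀ n : ℕ, 1 ≤ n →
    covenF^[n] covenZ (-(2 * (n : ℤ)) - 2) = 1 ∧
    covenF^[n] covenZ (-(2 * (n : ℤ)) - 1) = 1 ∧
    covenF^[n] covenZ (-(2 * (n : ℤ))) = 0 := by
  intro n _
  obtain ⟨h1, h0⟩ := covenF_iterate_covenZ_leftmost n
  exact ⟨h1 _ (by omega), h1 _ (by omega), h0⟩
end
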